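/- Suppose Condition (C) holds, ρ_k = 1 + 3r_k + O(r_k²) as k → ∞, and 0 ≤ β < 1. For n ≥ 2 let S_n = #{k ∈ [2,n] : k is a cutpoint of Y}. Then there exist constants 0 < c₃ < c₄ < ∞ such that c₃ ≤ liminf_{n→∞} E S_n/(log n · (log log n)^{−β}) ≤ limsup_{n→∞} E S_n/(log n · (log log n)^{−β}) ≤ c₄, and for each ε > 0, almost surely lim_{n→∞} S_n/((log n)^{1+ε}(log log n)^{−β}) = 0. -/

import Mathlib

open Filter MeasureTheory ENNReal Topology Asymptotics

noncomputable section

/-- Transition function of the (1,2) random walk `Y`. -/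
def transY (q p1 p2 : ℕ → ℝ) (n j : ℕ) : ℝ :=
  if n = 0 then (if j = 2 then 1 else 0)
  else if n = 1 then (if j = 0 then 1 else 0)
  else if j = n - 1 then q n
  else if j = n + 1 then p1 n
  else if j = n + 2 then p2 n
  else 0

/-- `μ` is the law (on path space) of the time-homogeneous Markov chain on `ℕ`
with one-step transition probabilities `p` and initial state `init`. -/
def IsMarkovChain (μ : Measure (ℕ → ℕ)) (p : ℕ → ℕ → ℝ) (init : ℕ) : Prop :=
  μ {ω | ω 0 = init} = 1 ∧
  ∀ (k : ℕ) (x : ℕ → ℕ) (j : ℕ),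
    μ {ω | (∀ i ≤ k, ω i = x i) ∧ ω (k + 1) = j}
      = ENNReal.ofReal (p (x k) j) * μ {ω | ∀ i ≤ k, ω i = x i}

/-- `ρ_k`, the spectral radius of the matrix `A_k`. -/
def rho (q p1 p2 : ℕ → ℝ) (k : ℕ) : ℝ :=
  ((p1 k + p2 k) / q k
    + Real.sqrt (((p1 k + p2 k) / q k) ^ 2 + 4 * (p2 k / q k))) / 2

/-- The perturbation `r_n = (1/3)(1/n + 1/(n (log log n)^β))` for `n ≥ 4`,
and `r_2 = r_3 = r_4`. -/
def rseq (β : ℝ) (n : ℕ) : ℝ :=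
  if 4 ≤ n then
    (1 / 3) * (1 / (n : ℝ) + 1 / ((n : ℝ) * Real.log (Real.log (n : ℝ)) ^ β))
  else
    (1 / 3) * (1 / (4 : ℝ) + 1 / ((4 : ℝ) * Real.log (Real.log (4 : ℝ)) ^ β))

/-- `S_n(ω)`: the number of cutpoints of the (1,2) walk lying in `[2,n]`;
a site `k` is a cutpoint when it is never visited. -/
def SY (ω : ℕ → ℕ) (n : ℕ) : ℕ :=
  {k : ℕ | 2 ≤ k ∧ k ≤ n ∧ (∀ m, ω m ≠ k)}.ncard

/-! ### Part A: Markov chain estimates -/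

/-- paths avoiding `k` up to time `m` -/
def avoid (k m : ℕ) : Set (ℕ → ℕ) := {ω | ∀ i ≤ m, ω i ≠ k}

lemma measurableSet_avoid (k m : ℕ) : MeasurableSet (avoid k m) := by
  have : avoid k m = ⋂ i, ⋂ (_ : i ≤ m), (fun ω : ℕ → ℕ => ω i) ⁻¹' {k}ᶜ := by
    ext ω; simp [avoid]
  rw [this]
  exact MeasurableSet.iInter fun i => MeasurableSet.iInter fun _ =>
    (measurable_pi_apply i) (MeasurableSet.of_discrete)

lemma cyl_step (μ : Measure (ℕ → ℕ)) (p : ℕ → ℕ → ℝ) (init : ℕ)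
    (hμ : IsMarkovChain μ p init) (k m : ℕ) (f : ℕ → ℝ≥0∞) :
    ∫⁻ ω in avoid k m, f (ω (m + 1)) ∂μ
      = ∫⁻ ω in avoid k m, (∑' j, ENNReal.ofReal (p (ω m) j) * f j) ∂μ := by
  classical
  -- projection
  let π : (ℕ → ℕ) → (Fin (m + 1) → ℕ) := fun ω i => ω i
  have hπ : Measurable π := measurable_pi_lambda _ fun i => measurable_pi_apply _
  let ev : (Fin (m+1) → ℕ) → ℝ≥0∞ := fun y => if ∀ i, y i ≠ k then 1 else 0
  have hind : ∀ (g : (ℕ → ℕ) → ℝ≥0∞), ∫⁻ ω in avoid k m, g ω ∂μ = ∫⁻ ω, ev (π ω) * g ω ∂μ := by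
    intro g
    rw [← lintegral_indicator (measurableSet_avoid k m)]
    congr 1; ext ω
    by_cases h : ω ∈ avoid k m
    · have : ∀ i, π ω i ≠ k := fun i => h i (by omega)
      simp only [ev, Set.indicator_of_mem h, if_pos this, one_mul]
    · have : ¬ ∀ i, π ω i ≠ k := fun h' => h (fun i hi => h' ⟨i, by omega⟩)
      simp only [ev, Set.indicator_of_notMem h, if_neg this, zero_mul]
  rw [hind, hind]
  let π2 : (ℕ → ℕ) → (Fin (m + 1) → ℕ) × ℕ := fun ω => (π ω, ω (m+1))
  have hπ2 : Measurable π2 := hπ.prodMk (measurable_pi_apply _)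
  have h1 : ∫⁻ ω, ev (π ω) * f (ω (m+1)) ∂μ
      = ∑' z : (Fin (m+1) → ℕ) × ℕ, ev z.1 * f z.2 * μ (π2 ⁻¹' {z}) := by
    have := lintegral_map (μ := μ) (f := fun z : (Fin (m+1) → ℕ) × ℕ => ev z.1 * f z.2) (g := π2)
      (measurable_of_countable _) hπ2
    rw [← this, lintegral_countable']
    congr 1; ext z
    rw [Measure.map_apply hπ2 (measurableSet_singleton _)]
  have h2 : ∫⁻ ω, ev (π ω) * (∑' j, ENNReal.ofReal (p (ω m) j) * f j) ∂μ
      = ∑' y : (Fin (m+1) → ℕ), ev y * (∑' j, ENNReal.ofReal (p (y (Fin.last m)) j) * f j) * μ (π ⁻¹' {y}) := by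
    have := lintegral_map (μ := μ) (f := fun y : (Fin (m+1) → ℕ) => ev y * (∑' j, ENNReal.ofReal (p (y (Fin.last m)) j) * f j)) (g := π)
      (measurable_of_countable _) hπ
    rw [lintegral_countable'] at this
    have h3 : ∀ ω : ℕ → ℕ, π ω (Fin.last m) = ω m := fun ω => by simp [π]
    simp only [h3] at this
    rw [← this]
    congr 1; ext z
    rw [Measure.map_apply hπ (measurableSet_singleton _)]
  rw [h1, h2, ENNReal.tsum_prod']
  congr 1; ext y
  rw [mul_assoc, ← ENNReal.tsum_mul_right, ← ENNReal.tsum_mul_left]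
  congr 1; ext j
  have key := hμ.2 m (fun i => if h : i < m + 1 then y ⟨i, h⟩ else 0) j
  have e1 : {ω : ℕ → ℕ | (∀ i ≤ m, ω i = if h : i < m + 1 then y ⟨i, h⟩ else 0) ∧ ω (m+1) = j} = π2 ⁻¹' {(y, j)} := by
    ext ω
    simp only [Set.mem_ofPred_eq, Set.mem_preimage, Set.mem_singleton_iff, π2, Prod.mk.injEq, π]
    refine and_congr_left fun _ => ⟨fun h => ?_, fun h i hi => ?_⟩
    · funext i
      have := h i (by omega)
      rw [dif_pos i.2] at this
      exact this
    · rw [dif_pos (by omega : i < m+1), ← h]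
  have e2 : {ω : ℕ → ℕ | (∀ i ≤ m, ω i = if h : i < m + 1 then y ⟨i, h⟩ else 0)} = π ⁻¹' {y} := by
    ext ω
    simp only [Set.mem_ofPred_eq, Set.mem_preimage, Set.mem_singleton_iff, π]
    refine ⟨fun h => ?_, fun h i hi => ?_⟩
    · funext i
      have := h i (by omega)
      rw [dif_pos i.2] at this
      exact this
    · rw [dif_pos (by omega : i < m+1), ← h]
  rw [e1, e2] at key
  have e3 : (if h : m < m + 1 then y ⟨m, h⟩ else 0) = y (Fin.last m) := by simp [Fin.last]
  simp only [e3] at key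
  simp only
  rw [key]
  ring

lemma super_mart (μ : Measure (ℕ → ℕ)) [IsProbabilityMeasure μ] (p : ℕ → ℕ → ℝ) (init : ℕ)
    (hμ : IsMarkovChain μ p init) (k : ℕ) (hk : init ≠ k) (f δ : ℕ → ℝ≥0∞)
    (hf : ∀ n, n ≠ k → (∑' j, ENNReal.ofReal (p n j) * f j) + δ n ≤ f n) (m : ℕ) :
    ∫⁻ ω in avoid k m, f (ω m) ∂μ + f k * μ (avoid k m)ᶜ
      + ∑ i ∈ Finset.range m, ∫⁻ ω in avoid k i, δ (ω i) ∂μ ≤ f init := by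
  have meas : ∀ (g : ℕ → ℝ≥0∞) (i : ℕ), Measurable fun ω : ℕ → ℕ => g (ω i) := fun g i =>
    (measurable_of_countable g).comp (measurable_pi_apply i)
  induction m with
  | zero =>
    have h0 : ∀ᵐ ω ∂μ, ω 0 = init := by
      have : MeasurableSet {ω : ℕ → ℕ | ω 0 = init} := 
        measurableSet_preimage (measurable_pi_apply (X := fun _ : ℕ => ℕ) 0)
          (MeasurableSet.of_discrete (s := ({init} : Set ℕ)))
      exact (prob_compl_eq_zero_iff this).2 hμ.1
    have h1 : μ (avoid k 0)ᶜ = 0 := by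
      refine measure_mono_null ?_ h0
      intro ω hω h
      apply hω
      intro i hi
      have : i = 0 := by omega
      subst this
      change ω 0 = init at h
      rw [h]; exact hk
    simp only [Finset.range_zero, Finset.sum_empty, h1, mul_zero, add_zero]
    calc ∫⁻ ω in avoid k 0, f (ω 0) ∂μ ≤ ∫⁻ ω, f (ω 0) ∂μ := setLIntegral_le_lintegral _ _
      _ = ∫⁻ ω, f init ∂μ := lintegral_congr_ae (h0.mono fun ω h => by simp only [h])
      _ = f init := by simp
  | succ m ih =>
    refine le_trans ?_ ih
    have hsub : avoid k (m+1) ⊆ avoid k m := fun ω h i hi => h i (by omega)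
    have h1 : ∫⁻ ω in avoid k m, f (ω (m+1)) ∂μ + ∫⁻ ω in avoid k m, δ (ω m) ∂μ 
        ≤ ∫⁻ ω in avoid k m, f (ω m) ∂μ := by
      rw [cyl_step μ p init hμ, ← lintegral_add_right _ (meas δ m)]
      refine setLIntegral_mono (meas f m) fun ω hω => hf _ (hω m le_rfl)
    have hdiff : avoid k m = avoid k (m+1) ∪ (avoid k m \ avoid k (m+1)) := by
      rw [Set.union_sdiff_cancel hsub]
    have h2 : ∫⁻ ω in avoid k m, f (ω (m+1)) ∂μ = ∫⁻ ω in avoid k (m+1), f (ω (m+1)) ∂μ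
        + f k * μ (avoid k m \ avoid k (m+1)) := by
      conv_lhs => rw [hdiff]
      rw [lintegral_union ((measurableSet_avoid k m).diff (measurableSet_avoid k (m+1)))
        Set.disjoint_sdiff_right]
      congr 1
      rw [← setLIntegral_const]
      refine setLIntegral_congr_fun ((measurableSet_avoid k m).diff (measurableSet_avoid k (m+1))) ?_
      intro ω hω
      have : ω (m+1) = k := by
        by_contra h
        apply hω.2
        intro i hi
        rcases Nat.lt_or_ge i (m+1) with h' | h'
        · exact hω.1 i (by omega)
        · have : i = m+1 := by omega
          subst this; exact h
      simp only [this]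
    have h3 : μ (avoid k (m+1))ᶜ = μ (avoid k m)ᶜ + μ (avoid k m \ avoid k (m+1)) := by
      rw [← measure_union _ ((measurableSet_avoid k m).diff (measurableSet_avoid k (m+1)))]
      · congr 1
        ext ω
        have := @hsub ω
        simp only [Set.mem_compl_iff, Set.mem_union, Set.mem_sdiff]
        tauto
      · exact Set.disjoint_left.2 fun ω h h' => h h'.1
    rw [Finset.sum_range_succ, h3]
    rw [h2] at h1
    calc _ = (∫⁻ ω in avoid k (m+1), f (ω (m+1)) ∂μ + f k * μ (avoid k m \ avoid k (m+1)) 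
          + ∫⁻ ω in avoid k m, δ (ω m) ∂μ) + f k * μ (avoid k m)ᶜ 
            + ∑ i ∈ Finset.range m, ∫⁻ ω in avoid k i, δ (ω i) ∂μ := by ring
      _ ≤ _ := by gcongr

/-- paths never visiting `k` -/
def never (k : ℕ) : Set (ℕ → ℕ) := {ω | ∀ m, ω m ≠ k}

lemma never_eq (k : ℕ) : never k = ⋂ m, avoid k m := by
  ext ω
  simp only [never, avoid, Set.mem_ofPred_eq, Set.mem_iInter]
  exact ⟨fun h m i _ => h i, fun h m => h m m le_rfl⟩

lemma measurableSet_never (k : ℕ) : MeasurableSet (never k) := by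
  rw [never_eq]; exact MeasurableSet.iInter fun m => measurableSet_avoid k m

lemma never_upper (μ : Measure (ℕ → ℕ)) [IsProbabilityMeasure μ] (p : ℕ → ℕ → ℝ) (init : ℕ)
    (hμ : IsMarkovChain μ p init) (k : ℕ) (hk : init ≠ k) (f δ : ℕ → ℝ≥0∞)
    (hf : ∀ n, n ≠ k → (∑' j, ENNReal.ofReal (p n j) * f j) + δ n ≤ f n)
    (hfin : f init ≠ ∞) (hδ : ∀ n, n ≠ k → δ n ≠ 0)
    (hlim : Tendsto f atTop (𝓝 1)) : μ (never k) ≤ f init := by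
  have meas : ∀ (g : ℕ → ℝ≥0∞) (i : ℕ), Measurable fun ω : ℕ → ℕ => g (ω i) := fun g i =>
    (measurable_of_countable g).comp (measurable_pi_apply i)
  have hsm := super_mart μ p init hμ k hk f δ hf
  have hsub : ∀ m, never k ⊆ avoid k m := fun m ω h i _ => h i
  have h1 : ∫⁻ ω in never k, ∑' i, δ (ω i) ∂μ ≤ f init := by
    rw [lintegral_tsum fun i => (meas δ i).aemeasurable]
    refine ENNReal.tsum_le_of_sum_range_le fun m => ?_
    refine le_trans ?_ (hsm m)
    refine le_trans (Finset.sum_le_sum fun i _ => lintegral_mono_set (hsub i)) ?_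
    exact le_add_self
  have h2 : ∀ᵐ ω ∂(μ.restrict (never k)), ∑' i, δ (ω i) < ∞ :=
    ae_lt_top (Measurable.tsum fun i => meas δ i) (ne_top_of_le_ne_top hfin h1)
  have h3 : ∀ᵐ ω ∂(μ.restrict (never k)), (1 : ℝ≥0∞) ≤ liminf (fun m => f (ω m)) atTop := by
    filter_upwards [h2, ae_restrict_mem (measurableSet_never k)] with ω hω hn
    have ht : Tendsto ω atTop atTop := by
      rw [Filter.tendsto_atTop]
      intro N
      have hz := ENNReal.tendsto_cofinite_zero_of_tsum_ne_top hω.ne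
      rw [Nat.cofinite_eq_atTop] at hz
      -- min of δ on states below N
      have hall : ∀ s < N, ∀ᶠ i in atTop, ω i ≠ s := by
        intro s _
        by_cases hs : s = k
        · exact Eventually.of_forall fun i => hs ▸ hn i
        · have := hz.eventually (gt_mem_nhds (pos_iff_ne_zero.2 (hδ s hs)))
          filter_upwards [this] with i hi h
          rw [h] at hi
          exact lt_irrefl _ hi
      have : ∀ᶠ i in atTop, ∀ s ∈ Finset.range N, ω i ≠ s := by
        rw [Filter.eventually_all_finset]
        intro s hs
        exact hall s (Finset.mem_range.1 hs)
      filter_upwards [this] with i hi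
      by_contra h
      exact hi (ω i) (Finset.mem_range.2 (by omega)) rfl
    exact (hlim.comp ht).liminf_eq.ge
  calc μ (never k) = ∫⁻ ω in never k, 1 ∂μ := by simp
    _ ≤ ∫⁻ ω in never k, liminf (fun m => f (ω m)) atTop ∂μ := lintegral_mono_ae h3
    _ ≤ liminf (fun m => ∫⁻ ω in never k, f (ω m) ∂μ) atTop :=
        lintegral_liminf_le fun m => meas f m
    _ ≤ f init := by
        refine liminf_le_of_le (by isBoundedDefault) fun b hb => ?_
        obtain ⟨m, hm⟩ := hb.exists
        refine hm.trans (le_trans ?_ (hsm m))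
        refine le_trans (lintegral_mono_set (hsub m)) ?_
        rw [add_assoc]
        exact le_self_add

lemma never_lower (μ : Measure (ℕ → ℕ)) [IsProbabilityMeasure μ] (p : ℕ → ℕ → ℝ) (init : ℕ)
    (hμ : IsMarkovChain μ p init) (k : ℕ) (hk : init ≠ k) (f : ℕ → ℝ≥0∞)
    (hf : ∀ n, n ≠ k → (∑' j, ENNReal.ofReal (p n j) * f j) ≤ f n)
    (hfk : 1 ≤ f k) : 1 ≤ μ (never k) + f init := by
  have hsm := super_mart μ p init hμ k hk f 0 (by simpa using hf)
  have h1 : μ (never k)ᶜ ≤ f init := by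
    rw [never_eq, Set.compl_iInter]
    have hmono : Monotone fun m => (avoid k m)ᶜ := by
      intro m n hmn
      exact Set.compl_subset_compl.2 fun ω h i hi => h i (hi.trans hmn)
    rw [hmono.measure_iUnion]
    refine iSup_le fun m => ?_
    refine le_trans ?_ (hsm m)
    calc μ (avoid k m)ᶜ = 1 * μ (avoid k m)ᶜ := by simp
      _ ≤ f k * μ (avoid k m)ᶜ := by gcongr
      _ ≤ _ := by rw [add_assoc]; exact le_add_left le_self_add
  calc (1 : ℝ≥0∞) = μ (never k) + μ (never k)ᶜ := by
        rw [measure_add_measure_compl (measurableSet_never k), measure_univ]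
    _ ≤ _ := by gcongr

/-! ### Part B: specialization to the walk `Y` -/

lemma tsum_transY_zero (q p1 p2 : ℕ → ℝ) (f : ℕ → ℝ) :
    ∑' j, ENNReal.ofReal (transY q p1 p2 0 j) * ENNReal.ofReal (f j) = ENNReal.ofReal (f 2) := by
  rw [tsum_eq_single 2]
  · simp [transY]
  · intro j hj; simp [transY, hj]

lemma tsum_transY_one (q p1 p2 : ℕ → ℝ) (f : ℕ → ℝ) :
    ∑' j, ENNReal.ofReal (transY q p1 p2 1 j) * ENNReal.ofReal (f j) = ENNReal.ofReal (f 0) := by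
  rw [tsum_eq_single 0]
  · simp [transY]
  · intro j hj; simp [transY, hj]

lemma tsum_transY (q p1 p2 : ℕ → ℝ) (f : ℕ → ℝ) (hf : ∀ n, 0 ≤ f n) (n : ℕ) (hn : 2 ≤ n)
    (hq : 0 < q n) (hp1 : 0 ≤ p1 n) (hp2 : 0 < p2 n) :
    ∑' j, ENNReal.ofReal (transY q p1 p2 n j) * ENNReal.ofReal (f j)
      = ENNReal.ofReal (q n * f (n - 1) + p1 n * f (n + 1) + p2 n * f (n + 2)) := by
  have h0 : n ≠ 0 := by omega
  have h1 : n ≠ 1 := by omega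
  rw [tsum_eq_sum (s := {n - 1, n + 1, n + 2})]
  · rw [Finset.sum_insert, Finset.sum_insert, Finset.sum_singleton]
    · have e1 : transY q p1 p2 n (n-1) = q n := by simp [transY, h0, h1]
      have e2 : transY q p1 p2 n (n+1) = p1 n := by
        have : n + 1 ≠ n - 1 := by omega
        simp [transY, h0, h1, this]
      have e3 : transY q p1 p2 n (n+2) = p2 n := by
        have : n + 2 ≠ n - 1 := by omega
        simp [transY, h0, h1, this]
      rw [e1, e2, e3, ← ENNReal.ofReal_mul hq.le, ← ENNReal.ofReal_mul hp1, 
        ← ENNReal.ofReal_mul hp2.le, ← ENNReal.ofReal_add, ← ENNReal.ofReal_add]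
      · ring_nf
      · exact mul_nonneg hq.le (hf _)
      · exact add_nonneg (mul_nonneg hp1 (hf _)) (mul_nonneg hp2.le (hf _))
      · exact mul_nonneg hp1 (hf _)
      · exact mul_nonneg hp2.le (hf _)
    · simp
    · simp only [Finset.mem_insert, Finset.mem_singleton]; omega
  · intro j hj
    simp only [Finset.mem_insert, Finset.mem_singleton, not_or] at hj
    simp [transY, h0, h1, hj]

lemma walk_upper (q p1 p2 : ℕ → ℝ)
    (hq : ∀ k, 2 ≤ k → 0 < q k) (hp1 : ∀ k, 2 ≤ k → 0 ≤ p1 k)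
    (hp2 : ∀ k, 2 ≤ k → 0 < p2 k)
    (μ : Measure (ℕ → ℕ)) [IsProbabilityMeasure μ]
    (hμ : IsMarkovChain μ (transY q p1 p2) 2) (k : ℕ) (hk : 3 ≤ k)
    (f : ℕ → ℝ) (hf : ∀ n, 0 ≤ f n) (h0 : f 2 < f 0) (h1 : f 0 < f 1)
    (h : ∀ n, 2 ≤ n → n ≠ k → q n * f (n - 1) + p1 n * f (n + 1) + p2 n * f (n + 2) < f n)
    (hlim : Tendsto f atTop (𝓝 1)) : μ (never k) ≤ ENNReal.ofReal (f 2) := by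
  let Pf : ℕ → ℝ := fun n => if n = 0 then f 2 else if n = 1 then f 0 else
    q n * f (n - 1) + p1 n * f (n + 1) + p2 n * f (n + 2)
  have hPf0 : ∀ n, 0 ≤ Pf n := by
    intro n
    simp only [Pf]
    split_ifs with a b
    · exact hf _
    · exact hf _
    · have hn : 2 ≤ n := by omega
      exact add_nonneg (add_nonneg (mul_nonneg (hq n hn).le (hf _)) (mul_nonneg (hp1 n hn) (hf _)))
        (mul_nonneg (hp2 n hn).le (hf _))
  have hPf : ∀ n, n ≠ k → Pf n < f n := by
    intro n hnk
    simp only [Pf]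
    split_ifs with a b
    · rw [a]; exact h0
    · rw [b]; exact h1
    · exact h n (by omega) hnk
  have hts : ∀ n, ∑' j, ENNReal.ofReal (transY q p1 p2 n j) * ENNReal.ofReal (f j) 
      = ENNReal.ofReal (Pf n) := by
    intro n
    simp only [Pf]
    split_ifs with a b
    · rw [a]; exact tsum_transY_zero ..
    · rw [b]; exact tsum_transY_one ..
    · have hn : 2 ≤ n := by omega
      exact tsum_transY q p1 p2 f hf n hn (hq n hn) (hp1 n hn) (hp2 n hn)
  refine never_upper μ _ 2 hμ k (by omega) (fun n => ENNReal.ofReal (f n)) 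
    (fun n => ENNReal.ofReal (f n - Pf n)) ?_ ENNReal.ofReal_ne_top ?_ ?_
  · intro n hn
    rw [hts, ← ENNReal.ofReal_add (hPf0 n) (by linarith [hPf n hn])]
    apply le_of_eq; congr 1; ring
  · intro n hn
    have := hPf n hn
    simp only [ne_eq, ENNReal.ofReal_eq_zero, not_le]
    linarith
  · simpa using ENNReal.tendsto_ofReal hlim

lemma walk_lower (q p1 p2 : ℕ → ℝ)
    (hq : ∀ k, 2 ≤ k → 0 < q k) (hp1 : ∀ k, 2 ≤ k → 0 ≤ p1 k)
    (hp2 : ∀ k, 2 ≤ k → 0 < p2 k) (hsum : ∀ k, 2 ≤ k → q k + p1 k + p2 k = 1)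
    (μ : Measure (ℕ → ℕ)) [IsProbabilityMeasure μ]
    (hμ : IsMarkovChain μ (transY q p1 p2) 2) (k : ℕ) (hk : 3 ≤ k)
    (g : ℕ → ℝ) (B : ℝ) (hB : 0 < B) (hg : ∀ n, g n ≤ B) (h0 : g 0 ≤ g 2) (h1 : g 1 ≤ g 0)
    (h : ∀ n, 2 ≤ n → n ≠ k → g n ≤ q n * g (n - 1) + p1 n * g (n + 1) + p2 n * g (n + 2))
    (hgk : g k ≤ 0) : g 2 / B ≤ μ.real (never k) := by
  set f : ℕ → ℝ := fun n => 1 - g n / B with hfdef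
  have hf : ∀ n, 0 ≤ f n := fun n => by
    have : g n / B ≤ 1 := (div_le_one hB).2 (hg n)
    simp only [f]; linarith
  have key : 1 ≤ μ (never k) + ENNReal.ofReal (f 2) := by
    refine never_lower μ _ 2 hμ k (by omega) (fun n => ENNReal.ofReal (f n)) ?_ ?_
    · intro n hn
      rcases Nat.lt_or_ge n 2 with h2 | h2
      · interval_cases n
        · rw [tsum_transY_zero]
          apply ENNReal.ofReal_le_ofReal
          have : g 0 / B ≤ g 2 / B := by gcongr
          simp only [f]; linarith
        · rw [tsum_transY_one]
          apply ENNReal.ofReal_le_ofReal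
          have : g 1 / B ≤ g 0 / B := by gcongr
          simp only [f]; linarith
      · rw [tsum_transY q p1 p2 f hf n h2 (hq n h2) (hp1 n h2) (hp2 n h2)]
        apply ENNReal.ofReal_le_ofReal
        have h3 := div_le_div_of_nonneg_right (h n h2 hn) hB.le
        have h4 := hsum n h2
        have h5 : q n * f (n-1) + p1 n * f (n+1) + p2 n * f (n+2) 
            = (q n + p1 n + p2 n) - (q n * g (n - 1) + p1 n * g (n + 1) + p2 n * g (n + 2)) / B := by
          simp only [f]; field_simp; ring
        rw [h5, h4]; simp only [f]; linarith
    · have : g k / B ≤ 0 := div_nonpos_of_nonpos_of_nonneg hgk hB.le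
      have h2 : 1 ≤ f k := by simp only [f]; linarith
      simpa using ENNReal.ofReal_le_ofReal h2
  have h2 : (1 : ℝ) ≤ μ.real (never k) + f 2 := by
    have := ENNReal.toReal_mono (by finiteness) key
    rw [ENNReal.toReal_add (by finiteness) (by finiteness), ENNReal.toReal_ofReal (hf 2)] at this
    simpa [Measure.real] using this
  simp only [f] at h2; linarith

/-! ### Part C: explicit super- and subharmonic functions -/

def psi (p2 : ℕ → ℝ) : ℕ → ℝ
  | 0 => 1
  | 1 => 0
  | 2 => 2
  | 3 => 3
  | (n + 4) => (psi p2 (n + 2) + 1) / p2 (n + 2)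

lemma psi_nonneg (p2 : ℕ → ℝ) (hp2 : ∀ k, 2 ≤ k → 0 < p2 k) : ∀ n, 0 ≤ psi p2 n
  | 0 => by simp [psi]
  | 1 => by simp [psi]
  | 2 => by simp [psi]
  | 3 => by simp [psi]
  | (n + 4) => by
    rw [psi]
    have := psi_nonneg p2 hp2 (n + 2)
    have := hp2 (n + 2) (by omega)
    positivity

lemma psi_rec (p2 : ℕ → ℝ) (hp2 : ∀ k, 2 ≤ k → 0 < p2 k) (n : ℕ) (hn : 2 ≤ n) :
    p2 n * psi p2 (n + 2) = psi p2 n + 1 := by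
  obtain ⟨m, rfl⟩ := Nat.exists_eq_add_of_le' hn
  have := hp2 (m + 2) (by omega)
  rw [show m + 2 + 2 = m + 4 by ring, psi]
  field_simp

/-- partial sums of `d` after `k` -/
def psum (d : ℕ → ℝ) (k n : ℕ) : ℝ := ∑ j ∈ Finset.range (n - k), d (k + 1 + j)

lemma psum_self (d : ℕ → ℝ) (k : ℕ) : psum d k k = 0 := by simp [psum]

lemma psum_succ (d : ℕ → ℝ) (k n : ℕ) (hn : k ≤ n) : psum d k (n + 1) = psum d k n + d (n + 1) := by
  unfold psum
  rw [show n + 1 - k = (n - k) + 1 by omega, Finset.sum_range_succ]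
  congr 2; omega

def dtail (d : ℕ → ℝ) (k : ℕ) : ℝ := ∑' j, d (k + 1 + j)

lemma psum_le_dtail (d : ℕ → ℝ) (hd : ∀ n, 0 < d n) (hs : Summable d) (k n : ℕ) :
    psum d k n ≤ dtail d k := by
  have hs' : Summable fun j => d (k + 1 + j) := by
    have := (summable_nat_add_iff (k+1)).2 hs
    simpa [add_comm] using this
  exact hs'.sum_le_tsum _ fun _ _ => (hd _).le

lemma psum_nonneg (d : ℕ → ℝ) (hd : ∀ n, 0 < d n) (k n : ℕ) : 0 ≤ psum d k n :=
  Finset.sum_nonneg fun _ _ => (hd _).le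

lemma psum_tendsto (d : ℕ → ℝ) (hs : Summable d) (k : ℕ) :
    Tendsto (psum d k) atTop (𝓝 (dtail d k)) := by
  have hs' : Summable fun j => d (k + 1 + j) := by
    have := (summable_nat_add_iff (k+1)).2 hs
    simpa [add_comm] using this
  exact hs'.hasSum.tendsto_sum_nat.comp (tendsto_sub_atTop_nat k)

lemma d_le_dtail (d : ℕ → ℝ) (hd : ∀ n, 0 < d n) (hs : Summable d) (k : ℕ) :
    d (k + 1) ≤ dtail d k := by
  have := psum_le_dtail d hd hs k (k + 1)
  rwa [psum_succ d k k le_rfl, psum_self, zero_add] at this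

lemma cut_upper (q p1 p2 : ℕ → ℝ)
    (hq : ∀ k, 2 ≤ k → 0 < q k) (hp1 : ∀ k, 2 ≤ k → 0 ≤ p1 k)
    (hp2 : ∀ k, 2 ≤ k → 0 < p2 k) (hsum : ∀ k, 2 ≤ k → q k + p1 k + p2 k = 1)
    (μ : Measure (ℕ → ℕ)) [IsProbabilityMeasure μ]
    (hμ : IsMarkovChain μ (transY q p1 p2) 2) (k : ℕ) (hk : 3 ≤ k)
    (d : ℕ → ℝ) (hd : ∀ n, 0 < d n) (hs : Summable d)
    (hsup : ∀ n, k < n → (p1 n + p2 n) * d (n + 1) + p2 n * d (n + 2) < q n * d n) :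
    μ.real (never k) ≤ 2 * (d (k + 1) / dtail d k) := by
  have hD : 0 < dtail d k := lt_of_lt_of_le (hd _) (d_le_dtail d hd hs k)
  set C := 2 * (d (k + 1) / dtail d k) with hC
  have hCpos : 0 < C := by have := hd (k+1); positivity
  set M := 1 + ∑ n ∈ Finset.range (k + 2), psi p2 n with hM
  have hMpos : 0 < M := by
    have := Finset.sum_nonneg (s := Finset.range (k+2)) fun n _ => psi_nonneg p2 hp2 n
    linarith
  have hψM : ∀ n, n < k + 2 → psi p2 n ≤ M := fun n hn => by
    have := Finset.single_le_sum (f := psi p2) (s := Finset.range (k+2))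
      (fun n _ => psi_nonneg p2 hp2 n) (Finset.mem_range.2 hn)
    linarith
  set ε := C / (2 * M) with hε
  have hεpos : 0 < ε := by positivity
  have hεψ : ∀ n, n < k + 2 → ε * psi p2 n ≤ C / 2 := fun n hn => by
    calc ε * psi p2 n ≤ ε * M := by gcongr; exact hψM n hn
      _ = C / 2 := by rw [hε]; field_simp
  set u : ℕ → ℝ := fun n => C - ε * psi p2 n with hu
  set f : ℕ → ℝ := fun n => if n < k then u n else psum d k n / dtail d k with hfdef
  have f_lt : ∀ n, n < k → f n = u n := fun n hn => by simp [f, hn]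
  have f_ge : ∀ n, k ≤ n → f n = psum d k n / dtail d k := fun n hn => by simp [f, not_lt.2 hn]
  have fk : f k = 0 := by rw [f_ge k le_rfl, psum_self]; simp
  have fk1 : f (k+1) = C / 2 := by
    rw [f_ge (k+1) (by omega), psum_succ d k k le_rfl, psum_self, hC]; ring
  have f_le : ∀ n, n < k + 2 → f n ≤ u n := by
    intro n hn
    rcases lt_trichotomy n k with h | h | h
    · rw [f_lt n h]
    · have := hεψ n hn
      rw [h, fk]; rw [h] at this; simp only [u]; linarith
    · have h' : n = k + 1 := by omega
      have := hεψ n hn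
      rw [h', fk1]; rw [h'] at this; simp only [u]; linarith
  have key : μ (never k) ≤ ENNReal.ofReal (f 2) := by
    refine walk_upper q p1 p2 hq hp1 hp2 μ hμ k hk f ?_ ?_ ?_ ?_ ?_
    · intro n
      rcases lt_or_ge n k with h | h
      · rw [f_lt n h]
        have := hεψ n (by omega)
        simp only [u]; linarith
      · rw [f_ge n h]
        exact div_nonneg (psum_nonneg d hd k n) hD.le
    · rw [f_lt 2 (by omega), f_lt 0 (by omega)]
      simp only [u, psi]; linarith
    · rw [f_lt 1 (by omega), f_lt 0 (by omega)]
      simp only [u, psi]; linarith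
    · intro n hn hnk
      have hqn := hq n hn
      have hp1n := hp1 n hn
      have hp2n := hp2 n hn
      have hsn := hsum n hn
      rcases lt_or_ge n k with h | h
      · have a1 := f_le (n-1) (by omega)
        have a2 := f_le (n+1) (by omega)
        have a3 := f_le (n+2) (by omega)
        have b1 := psi_nonneg p2 hp2 (n-1)
        have b2 := psi_nonneg p2 hp2 (n+1)
        have b3 := psi_rec p2 hp2 n hn
        rw [f_lt n h]
        calc q n * f (n-1) + p1 n * f (n+1) + p2 n * f (n+2) 
            ≤ q n * u (n-1) + p1 n * u (n+1) + p2 n * u (n+2) := by gcongr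
          _ = (q n + p1 n + p2 n) * C - ε * (q n * psi p2 (n-1) + p1 n * psi p2 (n+1)
                + p2 n * psi p2 (n+2)) := by simp only [u]; ring
          _ ≤ C - ε * (psi p2 n + 1) := by
              rw [hsn, b3]
              have : 0 ≤ q n * psi p2 (n-1) + p1 n * psi p2 (n+1) := by positivity
              have : 0 ≤ ε * (q n * psi p2 (n-1) + p1 n * psi p2 (n+1)) := by positivity
              linarith
          _ < u n := by simp only [u]; linarith
      · have hlt : k < n := by omega
        obtain ⟨m, rfl⟩ : ∃ m, n = m + 1 := ⟨n - 1, by omega⟩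
        rw [f_ge _ h, f_ge (m + 1 + 1) (by omega), f_ge (m + 1 + 2) (by omega), 
          Nat.add_sub_cancel, f_ge m (by omega)]
        have c1 := psum_succ d k m (by omega)
        have c2 := psum_succ d k (m+1) (by omega)
        have c3 := psum_succ d k (m+1+1) (by omega)
        have hs := hsup (m+1) hlt
        rw [← mul_div_assoc, ← mul_div_assoc, ← mul_div_assoc, ← add_div, ← add_div]
        apply div_lt_div_of_pos_right _ hD
        rw [show m + 1 + 2 = m + 1 + 1 + 1 by ring, c3, c2]
        rw [show m + 1 + 2 = m + 1 + 1 + 1 by ring] at hs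
        have c1' : psum d k m = psum d k (m+1) - d (m+1) := by linarith
        rw [c1']
        have : p2 (m+1) = 1 - q (m+1) - p1 (m+1) := by linarith
        rw [this] at hs ⊢
        nlinarith
    · have h1 : Tendsto (fun n => psum d k n / dtail d k) atTop (𝓝 1) := by
        have := (psum_tendsto d hs k).div_const (dtail d k)
        rwa [div_self hD.ne'] at this
      refine h1.congr' ?_
      filter_upwards [eventually_ge_atTop k] with n hn
      rw [f_ge n hn]
  have h2 : f 2 ≤ C := by
    rw [f_lt 2 (by omega)]
    have := psi_nonneg p2 hp2 2
    simp only [u]; nlinarith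
  have := ENNReal.toReal_mono (by finiteness) (key.trans (ENNReal.ofReal_le_ofReal h2))
  rwa [ENNReal.toReal_ofReal hCpos.le] at this

def eseq (q p1 p2 : ℕ → ℝ) : ℕ → ℝ
  | 0 => 0
  | 1 => 0
  | 2 => 0
  | 3 => 1
  | (n + 4) => (q (n + 2) * eseq q p1 p2 (n + 2)
      + (p1 (n + 2) + p2 (n + 2)) * eseq q p1 p2 (n + 3)) / p2 (n + 2)

section eseq
variable (q p1 p2 : ℕ → ℝ)

lemma eseq_rec (hp2 : ∀ k, 2 ≤ k → 0 < p2 k) (n : ℕ) (hn : 2 ≤ n) :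
    p2 n * eseq q p1 p2 (n + 2) = q n * eseq q p1 p2 n + (p1 n + p2 n) * eseq q p1 p2 (n + 1) := by
  obtain ⟨m, rfl⟩ := Nat.exists_eq_add_of_le' hn
  have := hp2 (m + 2) (by omega)
  rw [show m + 2 + 2 = m + 4 by ring, eseq]
  field_simp

lemma eseq_nonneg (hq : ∀ k, 2 ≤ k → 0 < q k)
    (hp1 : ∀ k, 2 ≤ k → 0 ≤ p1 k)
    (hp2 : ∀ k, 2 ≤ k → 0 < p2 k) : ∀ n, 0 ≤ eseq q p1 p2 n
  | 0 => by simp [eseq]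
  | 1 => by simp [eseq]
  | 2 => by simp [eseq]
  | 3 => by simp [eseq]
  | (n + 4) => by
    rw [eseq]
    have := eseq_nonneg hq hp1 hp2 (n + 2)
    have := eseq_nonneg hq hp1 hp2 (n + 3)
    have := hp2 (n + 2) (by omega)
    have := hp1 (n + 2) (by omega)
    have := hq (n + 2) (by omega)
    positivity

lemma eseq_add (hq : ∀ k, 2 ≤ k → 0 < q k)
    (hp1 : ∀ k, 2 ≤ k → 0 ≤ p1 k)
    (hp2 : ∀ k, 2 ≤ k → 0 < p2 k) (n : ℕ) (hn : 2 ≤ n) :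
    eseq q p1 p2 (n + 1) + q n / p2 n * eseq q p1 p2 n ≤ eseq q p1 p2 (n + 2) := by
  have h := eseq_rec q p1 p2 hp2 n hn
  have h1 := hp2 n hn
  have h2 := hp1 n hn
  have h3 := eseq_nonneg q p1 p2 hq hp1 hp2 (n + 1)
  have : eseq q p1 p2 (n+2) = (q n * eseq q p1 p2 n + (p1 n + p2 n) * eseq q p1 p2 (n + 1)) / p2 n := by
    rw [← h]; field_simp
  rw [this, le_div_iff₀ h1]
  have : (eseq q p1 p2 (n + 1) + q n / p2 n * eseq q p1 p2 n) * p2 n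
    = p2 n * eseq q p1 p2 (n + 1) + q n * eseq q p1 p2 n := by field_simp
  rw [this]
  nlinarith [mul_nonneg h2 h3]

lemma eseq_mono (hq : ∀ k, 2 ≤ k → 0 < q k)
    (hp1 : ∀ k, 2 ≤ k → 0 ≤ p1 k)
    (hp2 : ∀ k, 2 ≤ k → 0 < p2 k) : Monotone (eseq q p1 p2) := by
  refine monotone_nat_of_le_succ fun n => ?_
  match n with
  | 0 => simp [eseq]
  | 1 => simp [eseq]
  | 2 => simp [eseq]
  | (n + 3) =>
    have := eseq_add q p1 p2 hq hp1 hp2 (n + 2) (by omega)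
    have h1 := eseq_nonneg q p1 p2 hq hp1 hp2 (n+2)
    have h2 := hp2 (n+2) (by omega)
    have h3 := hq (n+2) (by omega)
    have : 0 ≤ q (n+2) / p2 (n+2) * eseq q p1 p2 (n+2) := by positivity
    have e1 : n + 2 + 1 = n + 3 := by ring
    have e2 : n + 2 + 2 = n + 3 + 1 := by ring
    rw [e1, e2] at *
    linarith

lemma eseq_le (hq : ∀ k, 2 ≤ k → 0 < q k)
    (hp1 : ∀ k, 2 ≤ k → 0 ≤ p1 k)
    (hp2 : ∀ k, 2 ≤ k → 0 < p2 k)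
    (hsum : ∀ k, 2 ≤ k → q k + p1 k + p2 k = 1) (n : ℕ) (hn : 2 ≤ n) : p2 n * eseq q p1 p2 (n + 2) ≤ eseq q p1 p2 (n + 1) := by
  rw [eseq_rec q p1 p2 hp2 n hn]
  have h := eseq_mono q p1 p2 hq hp1 hp2 (Nat.le_succ n)
  have h1 := hq n hn
  have h2 := hsum n hn
  calc _ ≤ q n * eseq q p1 p2 (n+1) + (p1 n + p2 n) * eseq q p1 p2 (n + 1) := by gcongr
    _ = (q n + p1 n + p2 n) * eseq q p1 p2 (n + 1) := by ring
    _ = _ := by rw [h2, one_mul]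

def Hs : ℕ → ℝ
  | 0 => 0
  | (n + 1) => Hs n + (-1) ^ n * eseq q p1 p2 (n + 1)

lemma Hs_bound (hq : ∀ k, 2 ≤ k → 0 < q k)
    (hp1 : ∀ k, 2 ≤ k → 0 ≤ p1 k)
    (hp2 : ∀ k, 2 ≤ k → 0 < p2 k) (n : ℕ) : 0 ≤ (-1) ^ (n + 1) * Hs q p1 p2 n ∧ (-1) ^ (n + 1) * Hs q p1 p2 n ≤ eseq q p1 p2 n := by
  induction n with
  | zero => simp [Hs, eseq]
  | succ n ih =>
    have e : (-1 : ℝ) ^ (n + 1 + 1) * Hs q p1 p2 (n + 1) = eseq q p1 p2 (n + 1) - (-1) ^ (n + 1) * Hs q p1 p2 n := by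
      have : ((-1 : ℝ) ^ n) * (-1) ^ n = 1 := by rw [← mul_pow]; simp
      rw [Hs, pow_succ, pow_succ]
      linear_combination (eseq q p1 p2 (n + 1)) * this
    have := eseq_mono q p1 p2 hq hp1 hp2 (Nat.le_succ n)
    simp only [Nat.succ_eq_add_one] at this
    rw [e]
    constructor <;> linarith

lemma Hs_harm (hp2 : ∀ k, 2 ≤ k → 0 < p2 k) (hsum : ∀ k, 2 ≤ k → q k + p1 k + p2 k = 1) (n : ℕ) (hn : 2 ≤ n) : 
    q n * Hs q p1 p2 (n - 1) + p1 n * Hs q p1 p2 (n + 1) + p2 n * Hs q p1 p2 (n + 2)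
      = Hs q p1 p2 n := by
  obtain ⟨m, rfl⟩ : ∃ m, n = m + 1 := ⟨n - 1, by omega⟩
  have h := eseq_rec q p1 p2 hp2 (m+1) hn
  have hs := hsum (m+1) hn
  rw [Nat.add_sub_cancel]
  have e1 : Hs q p1 p2 (m + 1) = Hs q p1 p2 m + (-1) ^ m * eseq q p1 p2 (m + 1) := rfl
  have e2 : Hs q p1 p2 (m + 1 + 1) = Hs q p1 p2 (m+1) + (-1) ^ (m+1) * eseq q p1 p2 (m + 1 + 1) := rfl
  have e3 : Hs q p1 p2 (m + 1 + 2) = Hs q p1 p2 (m+1+1) + (-1) ^ (m+2) * eseq q p1 p2 (m + 1 + 2) := rfl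
  rw [e3, e2, e1, pow_succ, pow_succ, pow_succ]
  linear_combination (Hs q p1 p2 m + (-1) ^ m * eseq q p1 p2 (m + 1)) * hs + (-1) ^ m * h

end eseq

lemma cut_lower (q p1 p2 : ℕ → ℝ)
    (hq : ∀ k, 2 ≤ k → 0 < q k) (hp1 : ∀ k, 2 ≤ k → 0 ≤ p1 k)
    (hp2 : ∀ k, 2 ≤ k → 0 < p2 k) (hsum : ∀ k, 2 ≤ k → q k + p1 k + p2 k = 1)
    (μ : Measure (ℕ → ℕ)) [IsProbabilityMeasure μ]
    (hμ : IsMarkovChain μ (transY q p1 p2) 2) (k : ℕ) (hk : 5 ≤ k)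
    (d : ℕ → ℝ) (hd : ∀ n, 0 < d n) (hs : Summable d)
    (hsub : ∀ n, k < n → q n * d n ≤ (p1 n + p2 n) * d (n + 1) + p2 n * d (n + 2))
    (η : ℝ) (hη : 0 < η) (hηq : ∀ n, k ≤ n + 3 → η ≤ q n) (hηp : ∀ n, k ≤ n + 3 → η ≤ p2 n) :
    η ^ 4 / 2 * (d (k + 1) / dtail d k) ≤ μ.real (never k) := by
  have hD : 0 < dtail d k := lt_of_lt_of_le (hd _) (d_le_dtail d hd hs k)
  set e := eseq q p1 p2 with he
  set H := Hs q p1 p2 with hH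
  have hen := eseq_nonneg q p1 p2 hq hp1 hp2
  have hem := eseq_mono q p1 p2 hq hp1 hp2
  have hepos : ∀ n, 3 ≤ n → 0 < e n := fun n hn => by
    have h1 : e 3 = 1 := by simp [he, eseq]
    have := hem hn
    rw [← he] at this
    linarith
  have hek := hepos (k+1) (by omega)
  set γ := d (k + 1) / dtail d k with hγ
  have hγpos : 0 < γ := div_pos (hd _) hD
  have hγ1 : γ ≤ 1 := (div_le_one hD).2 (d_le_dtail d hd hs k)
  set c := γ * (-1) ^ k / e (k + 1) with hc
  set v : ℕ → ℝ := fun n => c * (H n - H k) with hv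
  set g : ℕ → ℝ := fun n => if n < k then v n else psum d k n / dtail d k with hgdef
  have g_lt : ∀ n, n < k → g n = v n := fun n hn => by simp [g, hn]
  have g_ge : ∀ n, k ≤ n → g n = psum d k n / dtail d k := fun n hn => by simp [g, not_lt.2 hn]
  have gk : g k = 0 := by rw [g_ge k le_rfl, psum_self]; simp
  have gk1 : g (k+1) = γ := by
    rw [g_ge (k+1) (by omega), psum_succ d k k le_rfl, psum_self, hγ]; ring
  have hpow : ((-1 : ℝ) ^ k) * (-1) ^ k = 1 := by rw [← mul_pow]; simp
  have g_eq : ∀ n, n < k + 2 → g n = v n := by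
    intro n hn
    rcases lt_trichotomy n k with h | h | h
    · rw [g_lt n h]
    · rw [h, gk]; simp [v]
    · have h' : n = k + 1 := by omega
      rw [h', gk1]
      have : H (k+1) = H k + (-1) ^ k * e (k+1) := rfl
      simp only [v, this, hc]
      have e1 : γ * (-1) ^ k / e (k + 1) * (H k + (-1) ^ k * e (k + 1) - H k)
          = γ * ((-1) ^ k * (-1) ^ k) := by field_simp; ring
      rw [e1, hpow, mul_one]
  have hH2 : H 0 = 0 ∧ H 1 = 0 ∧ H 2 = 0 := by simp [hH, Hs, eseq]
  have main := walk_lower q p1 p2 hq hp1 hp2 hsum μ hμ k (by omega) g 2 two_pos ?_ ?_ ?_ ?_ gk.le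
  · have h2 : g 2 = γ * ((-1) ^ (k + 1) * H k / e (k+1)) := by
      rw [g_lt 2 (by omega)]
      simp only [v, hH2, hc, pow_succ]; ring
    obtain ⟨m, rfl⟩ : ∃ m, k = m + 3 := ⟨k - 3, by omega⟩
    -- lower bound on H k
    have hb : e (m + 3) - e (m + 2) ≤ (-1) ^ (m + 3 + 1) * H (m + 3) := by
      have h1 := (Hs_bound q p1 p2 hq hp1 hp2 (m+2)).2
      have h3 : H (m+3) = H (m+2) + (-1)^(m+2) * e (m+3) := rfl
      have hpow2 : ((-1 : ℝ) ^ m) * (-1) ^ m = 1 := by rw [← mul_pow]; simp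
      rw [h3]
      rw [← hH, ← he] at h1
      have : (-1 : ℝ) ^ (m + 3 + 1) * (H (m+2) + (-1)^(m+2) * e (m+3)) = e (m+3) - (-1) ^ (m + 2 + 1) * H (m+2) := by
        simp only [pow_succ]
        linear_combination (e (m+3)) * hpow2
      linarith
    have ha := eseq_add q p1 p2 hq hp1 hp2 (m + 1) (by omega)
    have l1 := eseq_le q p1 p2 hq hp1 hp2 hsum (m + 1) (by omega)
    have l2 := eseq_le q p1 p2 hq hp1 hp2 hsum (m + 2) (by omega)
    have l0 := eseq_le q p1 p2 hq hp1 hp2 hsum m (by omega)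
    simp only [← he, add_assoc, Nat.reduceAdd] at ha l1 l2 l0
    have n1 := hηp (m+1) (by omega)
    have n2 := hηp (m+2) (by omega)
    have n0 := hηp m (by omega)
    have nq := hηq (m+1) (by omega)
    have hqp : η ≤ q (m+1) / p2 (m+1) := by
      have h1 := hsum (m+1) (by omega)
      have h2 := hp1 (m+1) (by omega)
      have h3 := hp2 (m+1) (by omega)
      have h4 := hq (m+1) (by omega)
      rw [le_div_iff₀ h3]; nlinarith
    have e1 := hen (m+1)
    have e2 := hen (m+2)
    have e3 := hen (m+3)
    have e4 := hen (m+4)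
    simp only [← he] at e1 e2 e3 e4
    have f2 : η * e (m+4) ≤ e (m+3) := le_trans (by gcongr) l2
    have f1 : η * e (m+3) ≤ e (m+2) := le_trans (by gcongr) l1
    have f0 : η * e (m+2) ≤ e (m+1) := le_trans (by gcongr) l0
    have fin : η ^ 4 * e (m+4) ≤ (-1) ^ (m + 3 + 1) * H (m + 3) := by
      calc η ^ 4 * e (m+4) = η ^ 3 * (η * e (m+4)) := by ring
        _ ≤ η ^ 3 * e (m+3) := by gcongr
        _ = η ^ 2 * (η * e (m+3)) := by ring
        _ ≤ η ^ 2 * e (m+2) := by gcongr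
        _ = η * (η * e (m+2)) := by ring
        _ ≤ η * e (m+1) := by gcongr
        _ ≤ q (m+1) / p2 (m+1) * e (m+1) := by gcongr
        _ ≤ _ := by linarith
    refine le_trans ?_ main
    rw [h2]
    have : η ^ 4 ≤ (-1) ^ (m + 3 + 1) * H (m + 3) / e (m+3+1) := by
      rw [le_div_iff₀ hek]; exact fin
    have := mul_le_mul_of_nonneg_left this hγpos.le
    linarith
  · intro n
    rcases lt_or_ge n k with h | h
    · rw [g_lt n h]
      have b1 := Hs_bound q p1 p2 hq hp1 hp2 n
      have b2 := Hs_bound q p1 p2 hq hp1 hp2 k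
      simp only [← hH, ← he] at b1 b2
      have c1 : |H n| ≤ e (k+1) := by
        have : |H n| = |(-1) ^ (n + 1) * H n| := by rw [abs_mul]; simp
        rw [this, abs_of_nonneg b1.1]
        exact b1.2.trans (hem (by omega))
      have c2 : |H k| ≤ e (k+1) := by
        have : |H k| = |(-1) ^ (k + 1) * H k| := by rw [abs_mul]; simp
        rw [this, abs_of_nonneg b2.1]
        exact b2.2.trans (hem (by omega))
      have c3 : |c| = γ / e (k+1) := by
        rw [hc, abs_div, abs_mul]; simp [abs_of_pos hγpos, abs_of_pos hek]
      calc v n ≤ |c * (H n - H k)| := le_abs_self _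
        _ = γ / e (k+1) * |H n - H k| := by rw [abs_mul, c3]
        _ ≤ γ / e (k+1) * (|H n| + |H k|) := by gcongr; exact abs_sub _ _
        _ ≤ γ / e (k+1) * (e (k+1) + e (k+1)) := by gcongr
        _ = 2 * γ := by field_simp; ring
        _ ≤ 2 := by linarith
    · rw [g_ge n h]
      have := (div_le_one hD).2 (psum_le_dtail d hd hs k n)
      linarith
  · rw [g_lt 0 (by omega), g_lt 2 (by omega)]
    simp only [v, hH2]; exact le_rfl
  · rw [g_lt 0 (by omega), g_lt 1 (by omega)]
    simp only [v, hH2]; exact le_rfl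
  · intro n hn hnk
    have hsn := hsum n hn
    rcases lt_or_ge n k with h | h
    · rw [g_eq n (by omega), g_eq (n-1) (by omega), g_eq (n+1) (by omega), g_eq (n+2) (by omega)]
      apply le_of_eq
      have := Hs_harm q p1 p2 hp2 hsum n hn
      simp only [← hH] at this
      simp only [v]
      linear_combination (-c) * this + (c * H k) * hsn
    · have hlt : k < n := by omega
      obtain ⟨m, rfl⟩ : ∃ m, n = m + 1 := ⟨n - 1, by omega⟩
      rw [g_ge _ h, g_ge (m + 1 + 1) (by omega), g_ge (m + 1 + 2) (by omega), 
        Nat.add_sub_cancel, g_ge m (by omega)]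
      have c1 := psum_succ d k m (by omega)
      have c2 := psum_succ d k (m+1) (by omega)
      have c3 := psum_succ d k (m+1+1) (by omega)
      have hs := hsub (m+1) hlt
      rw [← mul_div_assoc, ← mul_div_assoc, ← mul_div_assoc, ← add_div, ← add_div]
      apply div_le_div_of_nonneg_right _ hD.le
      rw [show m + 1 + 2 = m + 1 + 1 + 1 by ring, c3, c2]
      rw [show m + 1 + 2 = m + 1 + 1 + 1 by ring] at hs
      have c1' : psum d k m = psum d k (m+1) - d (m+1) := by linarith
      rw [c1']
      have : p2 (m+1) = 1 - q (m+1) - p1 (m+1) := by linarith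
      rw [this] at hs ⊢
      nlinarith

/-! ### Part D: real analysis -/

def Lf (β : ℝ) (n : ℕ) : ℝ := Real.log (Real.log n) ^ β

def Hf (β : ℝ) (n : ℕ) : ℝ := Real.log n * Real.log (Real.log n) ^ (-β)

lemma ev_loglog (c : ℝ) : ∀ᶠ n : ℕ in atTop, ∀ x : ℝ, (n : ℝ) ≤ x →
    c ≤ Real.log (Real.log x) ∧ 1 ≤ Real.log x ∧ 1 ≤ x := by
  have h : ∀ᶠ x : ℝ in atTop, c ≤ Real.log (Real.log x) ∧ 1 ≤ Real.log x ∧ 1 ≤ x := by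
    have h1 := (Real.tendsto_log_atTop.comp Real.tendsto_log_atTop).eventually_ge_atTop c
    have h2 := Real.tendsto_log_atTop.eventually_ge_atTop 1
    filter_upwards [h1, h2, eventually_ge_atTop 1] with x a b c
    exact ⟨a, b, c⟩
  obtain ⟨X, hX⟩ := eventually_atTop.1 h
  have := tendsto_natCast_atTop_atTop (R := ℝ) |>.eventually_ge_atTop X
  filter_upwards [this] with n hn x hx
  exact hX x (hn.trans hx)

lemma hasDerivAt_loglog {x : ℝ} (hx : 1 ≤ x) (hlx : 1 ≤ Real.log x) :
    HasDerivAt (fun y => Real.log (Real.log y)) (1 / (x * Real.log x)) x := by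
  have h := (Real.hasDerivAt_log (by linarith : x ≠ 0)).log (by linarith : Real.log x ≠ 0)
  convert h using 1
  field_simp

lemma Lf_step (β : ℝ) (hβ0 : 0 ≤ β) (hβ1 : β < 1) : ∀ᶠ n : ℕ in atTop,
    1 ≤ Lf β n ∧ Lf β n ≤ Lf β (n + 1) ∧ Lf β n ≤ Real.log n ∧
    Lf β (n + 1) - Lf β n ≤ 1 / (n * Real.log n) := by
  filter_upwards [ev_loglog 1] with n hn
  obtain ⟨h1, h2, h3⟩ := hn n le_rfl
  have hcast : ((n + 1 : ℕ) : ℝ) = n + 1 := by push_cast; ring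
  have hder : ∀ x ∈ Set.Icc (n : ℝ) (n + 1), HasDerivAt (fun y => Real.log (Real.log y) ^ β)
      (1 / (x * Real.log x) * β * Real.log (Real.log x) ^ (β - 1)) x := by
    intro x hx
    obtain ⟨a1, a2, a3⟩ := hn x hx.1
    exact (hasDerivAt_loglog a3 a2).rpow_const (Or.inl (by linarith))
  obtain ⟨ξ, hξ, hξ'⟩ := exists_hasDerivAt_eq_slope (fun y => Real.log (Real.log y) ^ β) _ 
    (by linarith : (n : ℝ) < n + 1) 
    (fun x hx => (hder x hx).continuousAt.continuousWithinAt)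
    (fun x hx => hder x (Set.Ioo_subset_Icc_self hx))
  obtain ⟨a1, a2, a3⟩ := hn ξ hξ.1.le
  have hL : Lf β (n+1) - Lf β n = 1 / (ξ * Real.log ξ) * β * Real.log (Real.log ξ) ^ (β - 1) := by
    rw [hξ']; simp [Lf, hcast]
  have hpos : 0 < ξ * Real.log ξ := by positivity
  have hb : 0 ≤ Real.log (Real.log ξ) ^ (β - 1) := Real.rpow_nonneg (by linarith) _
  have hb1 : Real.log (Real.log ξ) ^ (β - 1) ≤ 1 := 
    Real.rpow_le_one_of_one_le_of_nonpos a1 (by linarith)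
  refine ⟨Real.one_le_rpow h1 hβ0, ?_, ?_, ?_⟩
  · have : 0 ≤ Lf β (n+1) - Lf β n := by rw [hL]; positivity
    linarith
  · calc Lf β n ≤ Real.log (Real.log n) ^ (1 : ℝ) := Real.rpow_le_rpow_of_exponent_le h1 hβ1.le
      _ = Real.log (Real.log n) := Real.rpow_one _
      _ ≤ Real.log n := by
        have := Real.log_le_sub_one_of_pos (by linarith : 0 < Real.log n)
        linarith
  · rw [hL]
    have hlog : Real.log n ≤ Real.log ξ := Real.log_le_log (by linarith) hξ.1.le
    calc _ ≤ 1 / (ξ * Real.log ξ) * 1 * 1 := by gcongr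
      _ = 1 / (ξ * Real.log ξ) := by ring
      _ ≤ _ := by 
        apply one_div_le_one_div_of_le (by positivity)
        have := hξ.1.le
        gcongr

lemma Lf_div (β : ℝ) (hβ0 : 0 ≤ β) (hβ1 : β < 1) : Tendsto (fun n : ℕ => Lf β n / n) atTop (𝓝 0) := by
  have h : Tendsto (fun n : ℕ => Real.log n / n) atTop (𝓝 0) := by
    have := Real.isLittleO_log_id_atTop.tendsto_div_nhds_zero
    exact this.comp tendsto_natCast_atTop_atTop
  refine squeeze_zero' ?_ ?_ h
  · filter_upwards [Lf_step β hβ0 hβ1] with n hn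
    have := hn.1; positivity
  · filter_upwards [Lf_step β hβ0 hβ1] with n hn
    have := hn.2.2.1; gcongr

lemma Hf_step (β : ℝ) (hβ0 : 0 ≤ β) (hβ1 : β < 1) : ∀ᶠ n : ℕ in atTop,
    1 / (2 * ((n + 1 : ℕ) * Lf β (n + 1))) ≤ Hf β (n + 1) - Hf β n ∧
    Hf β (n + 1) - Hf β n ≤ 1 / (n * Lf β n) := by
  filter_upwards [ev_loglog 2] with n hn
  obtain ⟨h1, h2, h3⟩ := hn n le_rfl
  have hcast : ((n + 1 : ℕ) : ℝ) = n + 1 := by push_cast; ring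
  have hder : ∀ x ∈ Set.Icc (n : ℝ) (n + 1), 
      HasDerivAt (fun y => Real.log y * Real.log (Real.log y) ^ (-β))
      (x⁻¹ * Real.log (Real.log x) ^ (-β) + Real.log x *
        (1 / (x * Real.log x) * (-β) * Real.log (Real.log x) ^ (-β - 1))) x := by
    intro x hx
    obtain ⟨a1, a2, a3⟩ := hn x hx.1
    exact (Real.hasDerivAt_log (by linarith)).mul
      ((hasDerivAt_loglog a3 a2).rpow_const (Or.inl (by linarith)))
  obtain ⟨ξ, hξ, hξ'⟩ := exists_hasDerivAt_eq_slope 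
    (fun y => Real.log y * Real.log (Real.log y) ^ (-β)) _ 
    (by linarith : (n : ℝ) < n + 1) 
    (fun x hx => (hder x hx).continuousAt.continuousWithinAt)
    (fun x hx => hder x (Set.Ioo_subset_Icc_self hx))
  obtain ⟨a1, a2, a3⟩ := hn ξ hξ.1.le
  have hlp : 0 < Real.log (Real.log ξ) := by linarith
  have hP : 0 < Real.log (Real.log ξ) ^ β := Real.rpow_pos_of_pos hlp _
  have hH : Hf β (n+1) - Hf β n = 1 / (ξ * Real.log (Real.log ξ) ^ β) 
      * (1 - β / Real.log (Real.log ξ)) := by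
    have : Hf β (n+1) - Hf β n = ξ⁻¹ * Real.log (Real.log ξ) ^ (-β) + Real.log ξ *
        (1 / (ξ * Real.log ξ) * (-β) * Real.log (Real.log ξ) ^ (-β - 1)) := by
      rw [hξ']; simp [Hf, hcast]
    rw [this, Real.rpow_sub_one hlp.ne', Real.rpow_neg hlp.le]
    field_simp
    ring
  have hfac0 : 1 / 2 ≤ 1 - β / Real.log (Real.log ξ) := by
    have : β / Real.log (Real.log ξ) ≤ 1 / 2 := by
      rw [div_le_div_iff₀ hlp two_pos]; linarith
    linarith
  have hfac1 : 1 - β / Real.log (Real.log ξ) ≤ 1 := by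
    have : 0 ≤ β / Real.log (Real.log ξ) := by positivity
    linarith
  have m1 : Lf β n ≤ Real.log (Real.log ξ) ^ β := by
    apply Real.rpow_le_rpow (by linarith) _ hβ0
    exact Real.log_le_log (by linarith) (Real.log_le_log (by linarith) hξ.1.le)
  have m2 : Real.log (Real.log ξ) ^ β ≤ Lf β (n+1) := by
    unfold Lf; rw [hcast]
    apply Real.rpow_le_rpow (by linarith) _ hβ0
    exact Real.log_le_log (by linarith) (Real.log_le_log (by linarith) hξ.2.le)
  have hLn : 0 < Lf β n := Real.rpow_pos_of_pos (by linarith) _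
  have i1 := hξ.1.le
  have i2 := hξ.2.le
  rw [hH]
  constructor
  · rw [hcast]
    calc 1 / (2 * ((n + 1) * Lf β (n + 1))) = 1 / ((n + 1) * Lf β (n + 1)) * (1 / 2) := by 
          rw [one_div, one_div, one_div, mul_inv]; ring
      _ ≤ 1 / (ξ * Real.log (Real.log ξ) ^ β) * (1 - β / Real.log (Real.log ξ)) := by gcongr
  · calc _ ≤ 1 / (ξ * Real.log (Real.log ξ) ^ β) * 1 := by gcongr
      _ = 1 / (ξ * Real.log (Real.log ξ) ^ β) := by ring
      _ ≤ _ := by gcongr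

lemma Hf_eq (β : ℝ) : ∀ᶠ n : ℕ in atTop, Hf β n = Real.log n / Lf β n ∧ 0 < Hf β n := by
  filter_upwards [ev_loglog 1] with n hn
  obtain ⟨h1, h2, h3⟩ := hn n le_rfl
  have e : Hf β n = Real.log n / Lf β n := by
    unfold Hf Lf
    rw [Real.rpow_neg (by linarith)]; rfl
  have : 0 < Lf β n := Real.rpow_pos_of_pos (by linarith) _
  exact ⟨e, by rw [e]; positivity⟩

lemma Hf_tendsto (β : ℝ) (hβ1 : β < 1) : Tendsto (Hf β) atTop atTop := by
  have h1 : Tendsto (fun n : ℕ => Real.sqrt (Real.log n) / 2) atTop atTop := by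
    refine Tendsto.atTop_div_const two_pos ?_
    exact Real.tendsto_sqrt_atTop.comp (Real.tendsto_log_atTop.comp tendsto_natCast_atTop_atTop)
  refine tendsto_atTop_mono' _ ?_ h1
  filter_upwards [ev_loglog 1, Hf_eq β] with n hn he
  obtain ⟨h1, h2, h3⟩ := hn n le_rfl
  have hLp : 0 < Lf β n := Real.rpow_pos_of_pos (by linarith) _
  have hs : 0 < Real.sqrt (Real.log n) := Real.sqrt_pos.2 (by linarith)
  have hss : Real.sqrt (Real.log n) * Real.sqrt (Real.log n) = Real.log n := 
    Real.mul_self_sqrt (by linarith)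
  have hL : Lf β n ≤ 2 * Real.sqrt (Real.log n) := by
    calc Lf β n ≤ Real.log (Real.log n) ^ (1 : ℝ) := Real.rpow_le_rpow_of_exponent_le h1 hβ1.le
      _ = Real.log (Real.log n) := Real.rpow_one _
      _ = Real.log (Real.sqrt (Real.log n) * Real.sqrt (Real.log n)) := by rw [hss]
      _ = 2 * Real.log (Real.sqrt (Real.log n)) := by rw [Real.log_mul hs.ne' hs.ne']; ring
      _ ≤ _ := by
        have := Real.log_le_sub_one_of_pos hs
        linarith
  rw [he.1, div_le_div_iff₀ two_pos hLp]
  nlinarith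

lemma summable_log_rpow (ε : ℝ) (hε : 0 < ε) :
    Summable fun n : ℕ => 1 / ((n : ℝ) * Real.log n ^ (1 + ε)) := by
  obtain ⟨N, hN⟩ := eventually_atTop.1 (ev_loglog 1)
  rw [← summable_nat_add_iff (N + 1)]
  have step : ∀ n ≥ N, 1 / (((n + 1 : ℕ) : ℝ) * Real.log (n + 1 : ℕ) ^ (1 + ε)) 
      ≤ (1 / ε) * (Real.log n ^ (-ε) - Real.log (n + 1 : ℕ) ^ (-ε)) := by
    intro n hn'
    have hn := hN n hn'
    have hcast : ((n + 1 : ℕ) : ℝ) = n + 1 := by push_cast; ring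
    have hder : ∀ x ∈ Set.Icc (n : ℝ) (n + 1), HasDerivAt (fun y => Real.log y ^ (-ε))
        (x⁻¹ * (-ε) * Real.log x ^ (-ε - 1)) x := by
      intro x hx
      obtain ⟨a1, a2, a3⟩ := hn x hx.1
      exact (Real.hasDerivAt_log (by linarith)).rpow_const (Or.inl (by linarith))
    obtain ⟨ξ, hξ, hξ'⟩ := exists_hasDerivAt_eq_slope (fun y => Real.log y ^ (-ε)) _ 
      (by linarith : (n : ℝ) < n + 1) 
      (fun x hx => (hder x hx).continuousAt.continuousWithinAt)
      (fun x hx => hder x (Set.Ioo_subset_Icc_self hx))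
    obtain ⟨a1, a2, a3⟩ := hn ξ hξ.1.le
    have hlp : 0 < Real.log ξ := by linarith
    have hlog : Real.log ξ ≤ Real.log (n+1) := Real.log_le_log (by linarith) hξ.2.le
    have i2 := hξ.2.le
    have e : Real.log n ^ (-ε) - Real.log (n + 1 : ℕ) ^ (-ε) = ε * (1 / (ξ * Real.log ξ ^ (1 + ε))) := by
      have : Real.log (n + 1 : ℕ) ^ (-ε) - Real.log n ^ (-ε) = ξ⁻¹ * (-ε) * Real.log ξ ^ (-ε - 1) := by
        rw [hξ']; simp
      rw [show -ε - 1 = -(1 + ε) by ring, Real.rpow_neg hlp.le] at this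
      rw [← neg_sub, this]; 
      have : 0 < Real.log ξ ^ (1+ε) := Real.rpow_pos_of_pos hlp _
      field_simp
    rw [e, ← mul_assoc, one_div_mul_cancel hε.ne', one_mul, hcast]
    have : 0 < Real.log ξ ^ (1+ε) := Real.rpow_pos_of_pos hlp _
    gcongr
  refine summable_of_sum_range_le (c := (1 / ε) * Real.log N ^ (-ε)) ?_ ?_
  · intro n
    obtain ⟨a1, a2, a3⟩ := hN N le_rfl ((n + (N+1) : ℕ) : ℝ) (by push_cast; linarith [(Nat.cast_nonneg n : (0:ℝ) ≤ n)])
    have : 0 ≤ Real.log ((n + (N+1) : ℕ) : ℝ) ^ (1 + ε) := Real.rpow_nonneg (by linarith) _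
    positivity
  · intro m
    have : ∑ i ∈ Finset.range m, 1 / (((i + (N + 1) : ℕ) : ℝ) * Real.log (i + (N + 1) : ℕ) ^ (1 + ε))
        ≤ (1 / ε) * (Real.log N ^ (-ε) - Real.log (N + m : ℕ) ^ (-ε)) := by
      induction m with
      | zero => simp
      | succ m ih =>
        rw [Finset.sum_range_succ]
        have := step (N + m) (by omega)
        rw [show m + (N + 1) = N + m + 1 by ring, show N + (m + 1) = N + m + 1 by ring]
        linarith
    refine this.trans ?_
    obtain ⟨a1, a2, a3⟩ := hN N le_rfl ((N + m : ℕ) : ℝ) (by push_cast; linarith [(Nat.cast_nonneg m : (0:ℝ) ≤ m)])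
    have : 0 ≤ Real.log ((N + m : ℕ) : ℝ) ^ (-ε) := Real.rpow_nonneg (by linarith) _
    gcongr
    linarith

/-- the model ratios -/
def xr (β s : ℝ) (n : ℕ) : ℝ := 1 + 1 / (n : ℝ) + 1 / (n * Lf β n) + s / (n : ℝ) ^ 2

lemma xr_props (β : ℝ) (hβ0 : 0 ≤ β) (hβ1 : β < 1) (s : ℝ) : ∀ᶠ n : ℕ in atTop,
    1 ≤ xr β s n ∧ xr β s n ≤ 2 ∧
    1 / 2 ≤ n * Lf β n * xr β s n - (n + 1 : ℕ) * Lf β (n + 1) ∧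
    n * Lf β n * xr β s n - (n + 1 : ℕ) * Lf β (n + 1) ≤ 2 := by
  have hdiv := Lf_div β hβ0 hβ1
  have h1 : ∀ᶠ n : ℕ in atTop, |s| * (Lf β n / n) < 1 / 4 := by
    have : Tendsto (fun n : ℕ => |s| * (Lf β n / n)) atTop (𝓝 0) := by
      simpa using hdiv.const_mul |s|
    exact this.eventually_lt_const (by norm_num)
  have hlog : ∀ᶠ n : ℕ in atTop, 8 ≤ Real.log n :=
    (Real.tendsto_log_atTop.comp tendsto_natCast_atTop_atTop).eventually_ge_atTop 8
  filter_upwards [Lf_step β hβ0 hβ1, h1, hlog, eventually_ge_atTop 4] with n hn h1 hlog hn4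
  obtain ⟨l1, l2, l3, l4⟩ := hn
  have hn4' : (4 : ℝ) ≤ n := by exact_mod_cast hn4
  have hnpos : (0 : ℝ) < n := by linarith
  have hLpos : 0 < Lf β n := by linarith
  have hsn : |s| / n < 1 / 4 := by
    calc |s| / n ≤ |s| * (Lf β n / n) := by
          rw [← mul_div_assoc]; gcongr; nlinarith [abs_nonneg s]
      _ < _ := h1
  have hinv : 1 / (n : ℝ) ≤ 1 / 4 := one_div_le_one_div_of_le (by norm_num) hn4'
  have hinv0 : 0 < 1 / (n : ℝ) := by positivity
  have hs2 : |s / (n : ℝ) ^ 2| ≤ 1 / 4 * (1 / n) := by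
    rw [abs_div, abs_of_pos (by positivity : (0:ℝ) < (n:ℝ)^2)]
    calc |s| / (n : ℝ) ^ 2 = |s| / n * (1 / n) := by field_simp
      _ ≤ _ := by gcongr
  have hs2' := abs_le.1 hs2
  have hLi : 0 < 1 / (n * Lf β n) := by positivity
  have hLi2 : 1 / (n * Lf β n) ≤ 1 / n := by
    apply one_div_le_one_div_of_le hnpos; nlinarith
  have hcast : ((n + 1 : ℕ) : ℝ) = n + 1 := by push_cast; ring
  have key : n * Lf β n * xr β s n - (n + 1 : ℕ) * Lf β (n + 1) 
      = 1 + s * (Lf β n / n) - (n + 1) * (Lf β (n+1) - Lf β n) := by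
    rw [hcast]; unfold xr; field_simp; ring
  have k1 : |s * (Lf β n / n)| ≤ 1 / 4 := by
    rw [abs_mul, abs_of_pos (by positivity : 0 < Lf β n / n)]; exact h1.le
  have k1' := abs_le.1 k1
  have k2 : (n + 1) * (Lf β (n+1) - Lf β n) ≤ 1 / 4 := by
    calc (n + 1) * (Lf β (n+1) - Lf β n) ≤ (n + n) * (1 / (n * Real.log n)) := by
          gcongr
          linarith
      _ = 2 / Real.log n := by field_simp; ring
      _ ≤ 2 / 8 := by gcongr
      _ = 1 / 4 := by norm_num
  have k3 : 0 ≤ (n + 1) * (Lf β (n+1) - Lf β n) := by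
    apply mul_nonneg <;> linarith
  refine ⟨?_, ?_, ?_, ?_⟩
  · unfold xr; linarith
  · unfold xr; linarith
  · rw [key]; linarith
  · rw [key]; linarith

lemma dseq_exists (β : ℝ) (hβ0 : 0 ≤ β) (hβ1 : β < 1) (s : ℝ) :
    ∃ d : ℕ → ℝ, (∀ n, 0 < d n) ∧ Summable d ∧ ∀ᶠ n : ℕ in atTop,
      d n = xr β s n * d (n + 1) ∧ dtail d n ≤ 4 * (n * Lf β n) * d (n + 1) ∧
      n * Lf β n * d (n + 1) ≤ 2 * dtail d n := by
  obtain ⟨N, hN⟩ := eventually_atTop.1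
    ((xr_props β hβ0 hβ1 s).and ((Lf_step β hβ0 hβ1).and (Hf_step β hβ0 hβ1)))
  let y : ℕ → ℝ := fun j => if N ≤ j then xr β s j else 1
  have hy : ∀ j, 0 < y j := by
    intro j
    simp only [y]
    split_ifs with h
    · linarith [(hN j h).1.1]
    · norm_num
  let d : ℕ → ℝ := fun n => ∏ j ∈ Finset.range n, (y j)⁻¹
  have hd : ∀ n, 0 < d n := fun n => Finset.prod_pos fun j _ => inv_pos.2 (hy j)
  have hdr : ∀ n ≥ N, d n = xr β s n * d (n + 1) := by
    intro n hn
    simp only [d]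
    rw [Finset.prod_range_succ]
    have : y n = xr β s n := by simp [y, hn]
    have h0 := hy n
    rw [this] at h0 ⊢
    field_simp
  let E : ℕ → ℝ := fun n => n * Lf β n * d n
  have hE0 : ∀ n ≥ N, 0 ≤ E n := fun n hn => by
    have := (hN n hn).2.1.1
    have := hd n
    positivity
  have hEd : ∀ n ≥ N, E n - E (n + 1) = 
      (n * Lf β n * xr β s n - (n + 1 : ℕ) * Lf β (n + 1)) * d (n + 1) := by
    intro n hn
    simp only [E]
    rw [hdr n hn]; ring
  have hE1 : ∀ n ≥ N, d (n + 1) ≤ 2 * (E n - E (n + 1)) := by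
    intro n hn
    rw [hEd n hn]
    nlinarith [(hN n hn).1.2.2.1, hd (n + 1)]
  have hE2 : ∀ n ≥ N, E n - E (n + 1) ≤ 2 * d (n + 1) := by
    intro n hn
    rw [hEd n hn]
    nlinarith [(hN n hn).1.2.2.2, hd (n + 1)]
  have S1 : ∀ k ≥ N, ∀ m, ∑ j ∈ Finset.range m, d (k + 1 + j) ≤ 2 * (E k - E (k + m)) := by
    intro k hk m
    induction m with
    | zero => simp
    | succ m ih =>
      rw [Finset.sum_range_succ]
      have := hE1 (k + m) (by omega)
      rw [show k + 1 + m = k + m + 1 by ring, show k + (m + 1) = k + m + 1 by ring]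
      linarith
  have S2 : ∀ k ≥ N, ∀ m, E k - E (k + m) ≤ 2 * ∑ j ∈ Finset.range m, d (k + 1 + j) := by
    intro k hk m
    induction m with
    | zero => simp
    | succ m ih =>
      rw [Finset.sum_range_succ]
      have := hE2 (k + m) (by omega)
      rw [show k + 1 + m = k + m + 1 by ring, show k + (m + 1) = k + m + 1 by ring]
      linarith
  have S1' : ∀ k ≥ N, ∀ m, ∑ j ∈ Finset.range m, d (k + 1 + j) ≤ 2 * E k := by
    intro k hk m
    have := S1 k hk m
    have := hE0 (k + m) (by omega)
    linarith
  have hsumk : ∀ k ≥ N, Summable fun j => d (k + 1 + j) := fun k hk =>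
    summable_of_sum_range_le (fun _ => (hd _).le) (S1' k hk)
  have hsum : Summable d := by
    rw [← summable_nat_add_iff (N + 1)]
    simpa [add_comm] using hsumk N le_rfl
  refine ⟨d, hd, hsum, ?_⟩
  filter_upwards [eventually_ge_atTop (N + 1)] with k hk
  have hkN : k ≥ N := by omega
  have hk1 : (1 : ℝ) ≤ k := by exact_mod_cast (by omega : 1 ≤ k)
  have hLk := (hN k hkN).2.1.1
  have hx1 := (hN k hkN).1.1
  have hx2 := (hN k hkN).1.2.1
  have hEk : E k = k * Lf β k * d (k + 1) * xr β s k := by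
    simp only [E]; rw [hdr k hkN]; ring
  have hpos : 0 < k * Lf β k * d (k + 1) := by have := hd (k+1); positivity
  refine ⟨hdr k hkN, ?_, ?_⟩
  · have : dtail d k ≤ 2 * E k := Real.tsum_le_of_sum_range_le (fun _ => (hd _).le) (S1' k hkN)
    nlinarith
  · -- E tends to zero
    have hEk2 : E k ≤ 2 * dtail d k := by
      refine le_of_forall_pos_le_add fun c hc => ?_
      have hex : ∃ m, E (k + m) < c := by
        by_contra hcon
        push Not at hcon
        have hdl : ∀ m, c * (1 / (((k + m : ℕ) : ℝ) * Lf β (k + m))) ≤ d (k + m) := by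
          intro m
          have h1 := hcon m
          have h2 := (hN (k + m) (by omega)).2.1.1
          have h3 : (0 : ℝ) < ((k + m : ℕ) : ℝ) := by exact_mod_cast (by omega : 0 < k + m)
          rw [mul_one_div, div_le_iff₀ (by positivity)]
          simp only [E] at h1
          linarith
        have hHb : ∀ m, c * (Hf β (k + m) - Hf β k) ≤ ∑ j ∈ Finset.range m, d (k + j) := by
          intro m
          induction m with
          | zero => simp
          | succ m ih =>
            rw [Finset.sum_range_succ]
            have h1 := hdl m
            have h2 := mul_le_mul_of_nonneg_left (hN (k + m) (by omega)).2.2.2 hc.le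
            rw [show k + (m + 1) = k + m + 1 by ring]
            linarith
        have hbd : ∀ m, Hf β (k + m) ≤ (∑' n, d n) / c + Hf β k := by
          intro m
          have h1 := hHb m
          have h2 : ∑ j ∈ Finset.range m, d (k + j) ≤ ∑' n, d n := by
            have hs' : Summable fun j => d (k + j) := by
              have := (summable_nat_add_iff k).2 hsum
              simpa [add_comm] using this
            calc _ ≤ ∑' j, d (k + j) := hs'.sum_le_tsum _ fun _ _ => (hd _).le
              _ = ∑' j, d (j + k) := by simp [add_comm]
              _ ≤ ∑' n, d n := by
                have := hsum.sum_add_tsum_nat_add k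
                have := Finset.sum_nonneg (s := Finset.range k) fun j _ => (hd j).le
                linarith
          have h3 : Hf β (k + m) - Hf β k ≤ (∑' n, d n) / c := by
            rw [le_div_iff₀ hc]; linarith
          linarith
        have ht := (Hf_tendsto β hβ1).comp (tendsto_add_atTop_nat k)
        obtain ⟨m, hm⟩ := (ht.eventually_gt_atTop ((∑' n, d n) / c + Hf β k)).exists
        have := hbd m
        simp only [Function.comp] at hm
        rw [add_comm m k] at hm
        linarith
      obtain ⟨m, hm⟩ := hex
      have h1 := S2 k hkN m
      have h2 : ∑ j ∈ Finset.range m, d (k + 1 + j) ≤ dtail d k := 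
        (hsumk k hkN).sum_le_tsum _ fun _ _ => (hd _).le
      linarith
    nlinarith

/-! ### Part E: ratio bounds -/

lemma rho_props (q p1 p2 : ℕ → ℝ) (n : ℕ) (hq : 0 < q n) (hp1 : 0 ≤ p1 n) (hp2 : 0 < p2 n) :
    0 < rho q p1 p2 n ∧
    q n * rho q p1 p2 n ^ 2 = (p1 n + p2 n) * rho q p1 p2 n + p2 n := by
  set A := (p1 n + p2 n) / q n with hA
  set B := p2 n / q n with hB
  have hA0 : 0 < A := by positivity
  have hB0 : 0 < B := by positivity
  have hr : rho q p1 p2 n = (A + Real.sqrt (A ^ 2 + 4 * B)) / 2 := rfl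
  have hs := Real.sq_sqrt (by positivity : 0 ≤ A ^ 2 + 4 * B)
  have hs0 := Real.sqrt_nonneg (A ^ 2 + 4 * B)
  have h1 : rho q p1 p2 n ^ 2 = A * rho q p1 p2 n + B := by
    rw [hr]; linear_combination (1 / 4) * hs
  refine ⟨by rw [hr]; positivity, ?_⟩
  rw [h1, hA, hB]; field_simp

lemma xr_diff (β : ℝ) (hβ0 : 0 ≤ β) (hβ1 : β < 1) : ∀ᶠ n : ℕ in atTop,
    xr β 0 (n + 1) ≤ xr β 0 n ∧ xr β 0 n ≤ xr β 0 (n + 1) + 3 / (n : ℝ) ^ 2 := by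
  filter_upwards [Lf_step β hβ0 hβ1, ev_loglog 1, eventually_ge_atTop 1] with n hn h2 h1
  obtain ⟨l1, l2, l3, l4⟩ := hn
  obtain ⟨-, m2, -⟩ := h2 n le_rfl
  have hn1 : (1 : ℝ) ≤ n := by exact_mod_cast h1
  have hcast : ((n + 1 : ℕ) : ℝ) = n + 1 := by push_cast; ring
  have hnL : n * (Lf β (n + 1) - Lf β n) ≤ 1 := by
    calc n * (Lf β (n + 1) - Lf β n) ≤ n * (1 / (n * Real.log n)) := by gcongr
      _ = 1 / Real.log n := by field_simp
      _ ≤ 1 := by rw [div_le_one (by linarith)]; exact m2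
  have hx : ∀ m, xr β 0 m = 1 + 1 / (m : ℝ) + 1 / (m * Lf β m) := fun m => by simp [xr]
  rw [hx, hx, hcast]
  set L := Lf β n
  set L' := Lf β (n + 1)
  constructor
  · have : 1 / ((n : ℝ) + 1) ≤ 1 / n := one_div_le_one_div_of_le (by linarith) (by linarith)
    have : 1 / (((n : ℝ) + 1) * L') ≤ 1 / (n * L) := by
      apply one_div_le_one_div_of_le (by positivity)
      gcongr; linarith
    linarith
  · have a1 : 1 / (n : ℝ) - 1 / ((n : ℝ) + 1) ≤ 1 / (n : ℝ) ^ 2 := by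
      have : 1 / (n : ℝ) - 1 / ((n : ℝ) + 1) = 1 / (n * (n + 1)) := by field_simp; ring
      rw [this]
      apply one_div_le_one_div_of_le (by positivity)
      nlinarith
    have hL' : 1 ≤ L' := by linarith
    have a2 : 1 / (n * L) - 1 / (((n : ℝ) + 1) * L') ≤ 2 / (n : ℝ) ^ 2 := by
      have : 1 / (n * L) - 1 / (((n : ℝ) + 1) * L') = (L' + n * (L' - L)) / (n * (n + 1) * L * L') := by
        field_simp; ring
      rw [this]
      calc (L' + n * (L' - L)) / (n * (n + 1) * L * L') ≤ (L' + L') / (n * n * 1 * L') := by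
            gcongr <;> linarith
        _ = 2 / (n : ℝ) ^ 2 := by field_simp; ring
    have e : 3 / (n : ℝ) ^ 2 = 1 / (n : ℝ) ^ 2 + 2 / (n : ℝ) ^ 2 := by ring
    linarith

lemma rseq_eq (β : ℝ) (n : ℕ) (hn : 4 ≤ n) : 1 + 3 * rseq β n = xr β 0 n := by
  simp only [rseq, hn, if_true, xr, Lf]; ring

lemma ratio_bounds (q p1 p2 : ℕ → ℝ) (β : ℝ) (hβ0 : 0 ≤ β) (hβ1 : β < 1)
    (hrho : (fun k => rho q p1 p2 k - (1 + 3 * rseq β k))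
      =O[atTop] fun k => rseq β k ^ 2) :
    ∃ K : ℝ, ∀ᶠ n : ℕ in atTop,
      xr β (-K) n ≤ rho q p1 p2 n ∧ xr β (-K) (n + 1) ≤ rho q p1 p2 n ∧
      rho q p1 p2 n < xr β K n ∧ rho q p1 p2 n ≤ xr β K (n + 1) := by
  obtain ⟨C, hC0, hC⟩ := hrho.exists_pos
  rw [Asymptotics.IsBigOWith] at hC
  refine ⟨4 * C + 13, ?_⟩
  filter_upwards [hC, xr_diff β hβ0 hβ1, Lf_step β hβ0 hβ1, eventually_ge_atTop 4] with n h1 h2 hL h4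
  rw [rseq_eq β n h4] at h1
  have hn4 : (4 : ℝ) ≤ n := by exact_mod_cast h4
  have hl := hL.1
  have hr : |rseq β n| ≤ 1 / n := by
    have e : rseq β n = (1 / 3) * (1 / (n : ℝ) + 1 / (n * Lf β n)) := by
      simp only [rseq, h4, if_true, Lf]
    have h0 : 0 < 1 / (n : ℝ) := by positivity
    have h3 : 0 < 1 / (n * Lf β n) := by positivity
    have h5 : 1 / (n * Lf β n) ≤ 1 / n := by
      apply one_div_le_one_div_of_le (by linarith); nlinarith
    rw [e, abs_of_pos (by positivity)]; linarith
  have hr2 : |rho q p1 p2 n - xr β 0 n| ≤ C * (1 / (n : ℝ) ^ 2) := by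
    refine (Real.norm_eq_abs _ ▸ h1).trans ?_
    rw [Real.norm_eq_abs, abs_pow]
    calc C * |rseq β n| ^ 2 ≤ C * (1 / n) ^ 2 := by gcongr
      _ = _ := by rw [div_pow, one_pow]
  have hr3 := abs_le.1 hr2
  have hx : ∀ s m, xr β s m = xr β 0 m + s * (1 / (m : ℝ) ^ 2) := fun s m => by
    simp only [xr]; ring
  have hcast : ((n + 1 : ℕ) : ℝ) = n + 1 := by push_cast; ring
  have hi : 1 / (4 : ℝ) * (1 / (n : ℝ) ^ 2) ≤ 1 / ((n + 1 : ℕ) : ℝ) ^ 2 := by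
    rw [hcast]
    rw [show 1 / (4 : ℝ) * (1 / (n : ℝ) ^ 2) = 1 / (2 * n) ^ 2 by rw [mul_pow]; field_simp; norm_num]
    gcongr; linarith
  have hi0 : 0 < 1 / (n : ℝ) ^ 2 := by positivity
  rw [hx _ n, hx _ (n+1), hx (4 * C + 13) n, hx (4 * C + 13) (n+1)]
  have e3 : 3 / (n : ℝ) ^ 2 = 3 * (1 / (n : ℝ) ^ 2) := by ring
  rw [e3] at h2
  obtain ⟨d1, d2⟩ := h2
  obtain ⟨d3, d4⟩ := hr3
  set z := 1 / (n : ℝ) ^ 2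
  set w := 1 / ((n + 1 : ℕ) : ℝ) ^ 2
  have hCz : 0 < C * z := by positivity
  have hKw : (4 * C + 13) * (1 / 4 * z) ≤ (4 * C + 13) * w := by gcongr
  refine ⟨?_, ?_, ?_, ?_⟩ <;> linarith

/-! ### Part F: two-sided bounds for the probability that `k` is a cutpoint -/

lemma cut_bounds (q p1 p2 : ℕ → ℝ)
    (hq : ∀ k, 2 ≤ k → 0 < q k) (hp1 : ∀ k, 2 ≤ k → 0 ≤ p1 k)
    (hp2 : ∀ k, 2 ≤ k → 0 < p2 k)
    (hsum : ∀ k, 2 ≤ k → q k + p1 k + p2 k = 1)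
    (μ : Measure (ℕ → ℕ)) [IsProbabilityMeasure μ]
    (hμ : IsMarkovChain μ (transY q p1 p2) 2)
    (a b : ℝ) (ha : 0 < a) (hb : 0 < b)
    (hCa : Tendsto (fun k => (p1 k + p2 k) / q k) atTop (𝓝 a))
    (hCb : Tendsto (fun k => p2 k / q k) atTop (𝓝 b))
    (β : ℝ) (hβ0 : 0 ≤ β) (hβ1 : β < 1)
    (hrho : (fun k => rho q p1 p2 k - (1 + 3 * rseq β k))
      =O[atTop] fun k => rseq β k ^ 2) :
    ∃ c C : ℝ, 0 < c ∧ 0 < C ∧ ∀ᶠ k : ℕ in atTop,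
      c * (1 / (k * Lf β k)) ≤ μ.real (never k) ∧ μ.real (never k) ≤ C * (1 / (k * Lf β k)) := by
  obtain ⟨K, hK⟩ := ratio_bounds q p1 p2 β hβ0 hβ1 hrho
  obtain ⟨d, hd, hds, hdev⟩ := dseq_exists β hβ0 hβ1 K
  obtain ⟨d', hd', hds', hdev'⟩ := dseq_exists β hβ0 hβ1 (-K)
  -- lower bounds for q and p2
  have hqlim : Tendsto q atTop (𝓝 (1 / (1 + a))) := by
    have : Tendsto (fun k => 1 / (1 + (p1 k + p2 k) / q k)) atTop (𝓝 (1 / (1 + a))) :=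
      (tendsto_const_nhds.div (tendsto_const_nhds.add hCa) (by linarith))
    refine this.congr' ?_
    filter_upwards [eventually_ge_atTop 2] with k hk
    have h1 := hq k hk
    have h2 := hsum k hk
    have : 1 + (p1 k + p2 k) / q k = 1 / q k := by
      field_simp; linarith
    rw [this, one_div_one_div]
  have hplim : Tendsto p2 atTop (𝓝 (b * (1 / (1 + a)))) := by
    refine (hCb.mul hqlim).congr' ?_
    filter_upwards [eventually_ge_atTop 2] with k hk
    have h1 := hq k hk
    field_simp
  set η := min (1 / (1 + a)) (b * (1 / (1 + a))) / 2 with hη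
  have hmin : 0 < min (1 / (1 + a)) (b * (1 / (1 + a))) := by
    apply lt_min <;> positivity
  have hηpos : 0 < η := by positivity
  have hηq : ∀ᶠ k in atTop, η ≤ q k := by
    refine (hqlim.eventually_const_lt ?_).mono fun k h => h.le
    have := min_le_left (1 / (1 + a)) (b * (1 / (1 + a)))
    linarith
  have hηp : ∀ᶠ k in atTop, η ≤ p2 k := by
    refine (hplim.eventually_const_lt ?_).mono fun k h => h.le
    have := min_le_right (1 / (1 + a)) (b * (1 / (1 + a)))
    linarith
  obtain ⟨N, hN⟩ := eventually_atTop.1 (hK.and (hdev.and (hdev'.and (hηq.and (hηp.and 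
    (Lf_step β hβ0 hβ1))))))
  refine ⟨η ^ 4 / 2 / 4, 2 * 2, by positivity, by positivity, ?_⟩
  filter_upwards [eventually_ge_atTop (N + 5)] with k hk
  obtain ⟨-, ⟨-, -, t1⟩, ⟨-, t2, -⟩, -, -, l1, -⟩ := hN k (by omega)
  have hk1 : (1 : ℝ) ≤ k := by exact_mod_cast (by omega : 1 ≤ k)
  have hkL : 0 < k * Lf β k := by positivity
  constructor
  · have hD : 0 < dtail d' k := lt_of_lt_of_le (hd' _) (d_le_dtail d' hd' hds' k)
    have := cut_lower q p1 p2 hq hp1 hp2 hsum μ hμ k (by omega) d' hd' hds' ?_ η hηpos 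
      (fun n hn => (hN n (by omega)).2.2.2.1) (fun n hn => (hN n (by omega)).2.2.2.2.1)
    · refine le_trans ?_ this
      have h2 : 1 / 4 * (1 / (k * Lf β k)) ≤ d' (k + 1) / dtail d' k := by
        rw [show (1 : ℝ) / 4 * (1 / (k * Lf β k)) = 1 / (4 * (k * Lf β k)) by field_simp,
          div_le_div_iff₀ (by positivity) hD]
        linarith
      have h3 : 0 ≤ η ^ 4 / 2 := by positivity
      calc η ^ 4 / 2 / 4 * (1 / (k * Lf β k)) = η ^ 4 / 2 * (1 / 4 * (1 / (k * Lf β k))) := by ring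
        _ ≤ _ := by gcongr
    · intro n hn
      have hn2 : 2 ≤ n := by omega
      obtain ⟨⟨r1, r2, -, -⟩, -, ⟨e1, -⟩, -⟩ := hN n (by omega)
      obtain ⟨-, -, ⟨e2, -⟩, -⟩ := hN (n + 1) (by omega)
      obtain ⟨ρ0, ρ1⟩ := rho_props q p1 p2 n (hq n hn2) (hp1 n hn2) (hp2 n hn2)
      rw [show n + 1 + 1 = n + 2 by ring] at e2
      set ρ := rho q p1 p2 n
      set x := xr β (-K) n
      set x' := xr β (-K) (n + 1)
      have hd2 := hd' (n + 2)
      have hd1 := hd' (n + 1)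
      have hx' : 0 < x' := by
        by_contra h
        push Not at h
        nlinarith
      have hqn := hq n hn2
      have hpn := hp2 n hn2
      have s0 : 0 < q n * ρ - (p1 n + p2 n) := by
        have : (q n * ρ - (p1 n + p2 n)) * ρ = p2 n := by linear_combination ρ1
        by_contra h
        push Not at h
        nlinarith
      have s1 : (q n * ρ - (p1 n + p2 n)) * x' ≤ p2 n := by
        have : (q n * ρ - (p1 n + p2 n)) * ρ = p2 n := by linear_combination ρ1
        calc (q n * ρ - (p1 n + p2 n)) * x' ≤ (q n * ρ - (p1 n + p2 n)) * ρ := by gcongr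
          _ = p2 n := this
      have s2 : q n * x * x' ≤ q n * ρ * x' := by gcongr
      have s3 : q n * x * x' ≤ (p1 n + p2 n) * x' + p2 n := by linarith
      rw [e1, e2]
      calc q n * (x * (x' * d' (n + 2))) = (q n * x * x') * d' (n + 2) := by ring
        _ ≤ ((p1 n + p2 n) * x' + p2 n) * d' (n + 2) := by gcongr
        _ = _ := by ring
  · have hD : 0 < dtail d k := lt_of_lt_of_le (hd _) (d_le_dtail d hd hds k)
    have := cut_upper q p1 p2 hq hp1 hp2 hsum μ hμ k (by omega) d hd hds ?_
    · refine this.trans ?_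
      have h2 : d (k + 1) / dtail d k ≤ 2 * (1 / (k * Lf β k)) := by
        rw [mul_one_div, div_le_div_iff₀ hD hkL]
        linarith
      linarith
    · intro n hn
      have hn2 : 2 ≤ n := by omega
      obtain ⟨⟨-, -, r1, r2⟩, ⟨e1, -⟩, -⟩ := hN n (by omega)
      obtain ⟨-, ⟨e2, -⟩, -⟩ := hN (n + 1) (by omega)
      obtain ⟨ρ0, ρ1⟩ := rho_props q p1 p2 n (hq n hn2) (hp1 n hn2) (hp2 n hn2)
      rw [show n + 1 + 1 = n + 2 by ring] at e2
      set ρ := rho q p1 p2 n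
      set x := xr β K n
      set x' := xr β K (n + 1)
      have hd2 := hd (n + 2)
      have hx' : 0 < x' := by linarith
      have hqn := hq n hn2
      have hpn := hp2 n hn2
      have s0 : 0 < q n * ρ - (p1 n + p2 n) := by
        have : (q n * ρ - (p1 n + p2 n)) * ρ = p2 n := by linear_combination ρ1
        by_contra h
        push Not at h
        nlinarith
      have s1 : p2 n ≤ (q n * ρ - (p1 n + p2 n)) * x' := by
        have : (q n * ρ - (p1 n + p2 n)) * ρ = p2 n := by linear_combination ρ1
        conv_lhs => rw [← this]
        gcongr
      have s2 : q n * ρ * x' < q n * x * x' := by gcongr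
      have s3 : (p1 n + p2 n) * x' + p2 n < q n * x * x' := by linarith
      rw [e1, e2]
      calc _ = ((p1 n + p2 n) * x' + p2 n) * d (n + 2) := by ring
        _ < (q n * x * x') * d (n + 2) := by gcongr
        _ = _ := by ring

/-! ### Part G: the count of cutpoints -/

lemma kronecker (x w : ℕ → ℝ) (hx0 : ∀ k, 0 ≤ x k) (hx1 : ∀ k, x k ≤ 1) (N : ℕ)
    (hw : ∀ n ≥ N, 0 < w n) (hmono : ∀ k ≥ N, ∀ n ≥ k, w k ≤ w n)
    (hlim : Tendsto w atTop atTop) (hs : Summable fun k => x (k + N) / w (k + N)) :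
    Tendsto (fun n => (∑ k ∈ Finset.Icc 2 n, x k) / w n) atTop (𝓝 0) := by
  have key := tendsto_tsum_of_dominated_convergence (𝓕 := atTop)
    (f := fun n k => if k ∈ Finset.Icc 2 n then x k / w n else 0) (g := fun _ : ℕ => (0 : ℝ))
    (bound := fun k => if k < N then 1 else x k / w k) ?_ ?_ ?_
  · rw [tsum_zero] at key
    refine key.congr fun n => ?_
    rw [tsum_eq_sum (s := Finset.Icc 2 n) (fun k hk => by simp only [hk, if_false]),
      Finset.sum_div]
    exact Finset.sum_congr rfl fun k hk => by simp only [hk, if_true]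
  · rw [← summable_nat_add_iff N]
    simpa using hs
  · intro k
    have h1 : Tendsto (fun n => x k / w n) atTop (𝓝 0) := hlim.const_div_atTop _
    refine squeeze_zero' ?_ ?_ h1
    · filter_upwards [eventually_ge_atTop N] with n hn
      have := hw n hn
      have := hx0 k
      split_ifs <;> positivity
    · filter_upwards [eventually_ge_atTop N] with n hn
      have := hw n hn
      have := hx0 k
      split_ifs
      · exact le_rfl
      · positivity
  · filter_upwards [eventually_ge_atTop N, hlim.eventually_ge_atTop 1] with n hn hn1 k
    have hwn := hw n hn
    have h0 := hx0 k
    have h1 := hx1 k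
    by_cases hk : k ∈ Finset.Icc 2 n
    · simp only [hk, if_true]
      rw [Real.norm_of_nonneg (by positivity)]
      split_ifs with hkN
      · rw [div_le_one hwn]; linarith
      · have hkN' : N ≤ k := by omega
        exact div_le_div_of_nonneg_left h0 (hw k hkN') (hmono k hkN' n (Finset.mem_Icc.1 hk).2)
    · simp only [hk, if_false, norm_zero]
      split_ifs with hkN
      · norm_num
      · have := hw k (by omega)
        positivity

lemma SY_eq (ω : ℕ → ℕ) (n : ℕ) :
    (SY ω n : ℝ) = ∑ k ∈ Finset.Icc 2 n, (never k).indicator (fun _ => (1 : ℝ)) ω := by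
  classical
  have : {k : ℕ | 2 ≤ k ∧ k ≤ n ∧ (∀ m, ω m ≠ k)}
      = ((Finset.Icc 2 n).filter (fun k => ω ∈ never k) : Finset ℕ) := by
    ext k
    rw [Finset.mem_coe, Finset.mem_filter, Finset.mem_Icc, and_assoc]
    rfl
  rw [SY, this, Set.ncard_coe_finset]
  simp [Set.indicator_apply, Finset.sum_boole]

lemma integral_SY (μ : Measure (ℕ → ℕ)) [IsProbabilityMeasure μ] (n : ℕ) :
    ∫ ω, (SY ω n : ℝ) ∂μ = ∑ k ∈ Finset.Icc 2 n, μ.real (never k) := by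
  simp_rw [SY_eq]
  rw [integral_finsetSum]
  · refine Finset.sum_congr rfl fun k _ => ?_
    rw [integral_indicator_const _ (measurableSet_never k)]; simp
  · intro k _
    exact (integrable_const (1 : ℝ)).indicator (measurableSet_never k)

lemma expect_bounds (β : ℝ) (hβ0 : 0 ≤ β) (hβ1 : β < 1) (P : ℕ → ℝ) (hP : ∀ k, 0 ≤ P k)
    (c C : ℝ) (hc : 0 < c) (hC : 0 < C)
    (h : ∀ᶠ k : ℕ in atTop, c * (1 / (k * Lf β k)) ≤ P k ∧ P k ≤ C * (1 / (k * Lf β k))) :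
    ∀ᶠ n in atTop, c / 2 ≤ (∑ k ∈ Finset.Icc 2 n, P k) / Hf β n ∧
      (∑ k ∈ Finset.Icc 2 n, P k) / Hf β n ≤ 2 * C + 1 := by
  obtain ⟨N, hN⟩ := eventually_atTop.1 (h.and ((Hf_step β hβ0 hβ1).and (Hf_eq β)))
  set M := N + 2 with hM
  set E := fun n => ∑ k ∈ Finset.Icc 2 n, P k with hE
  have hEs : ∀ n, 1 ≤ n → E (n + 1) = E n + P (n + 1) := by
    intro n hn
    simp only [hE]
    rw [Finset.sum_Icc_succ_top (by omega)]
  have hstep : ∀ n ≥ M, Hf β n ≤ Hf β (n + 1) ∧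
      1 / (((n + 1 : ℕ) : ℝ) * Lf β (n + 1)) ≤ 2 * (Hf β (n + 1) - Hf β n) := by
    intro n hn
    have h1 := (hN n (by omega)).2.1.1
    have e0 := (hN (n + 1) (by omega)).1
    have e1 : 0 ≤ 1 / (((n + 1 : ℕ) : ℝ) * Lf β (n + 1)) := by
      have : 0 ≤ C * (1 / (((n + 1 : ℕ) : ℝ) * Lf β (n + 1))) := (hP _).trans e0.2
      exact nonneg_of_mul_nonneg_right this hC
    have e2 : 1 / (2 * (((n + 1 : ℕ) : ℝ) * Lf β (n + 1)))
        = 1 / 2 * (1 / (((n + 1 : ℕ) : ℝ) * Lf β (n + 1))) := by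
      rw [← one_div_mul_one_div]
    rw [e2] at h1
    constructor <;> linarith
  have hup : ∀ n ≥ M, E n ≤ E M + 2 * C * (Hf β n - Hf β M) := by
    intro n hn
    induction n, hn using Nat.le_induction with
    | base => simp
    | succ n hn ih =>
      rw [hEs n (by omega)]
      have h1 := (hN (n + 1) (by omega)).1.2
      have h2 := mul_le_mul_of_nonneg_left (hstep n hn).2 hC.le
      linarith
  have hlo : ∀ n ≥ M, c * (Hf β (n + 1) - Hf β (M + 1)) ≤ E n := by
    intro n hn
    induction n, hn using Nat.le_induction with
    | base => simpa using Finset.sum_nonneg fun k _ => hP k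
    | succ n hn ih =>
      rw [hEs n (by omega)]
      have h1 := (hN (n + 1) (by omega)).1.1
      have h2 := mul_le_mul_of_nonneg_left (hN (n + 1) (by omega)).2.1.2 hc.le
      linarith
  have hE0 : 0 ≤ E M := Finset.sum_nonneg fun k _ => hP k
  filter_upwards [eventually_ge_atTop M, (Hf_tendsto β hβ1).eventually_ge_atTop (E M),
    (Hf_tendsto β hβ1).eventually_ge_atTop (2 * Hf β (M + 1))] with n hn h1 h2
  have hpos := (hN n (by omega)).2.2.2
  have hposM := (hN M (by omega)).2.2.2
  constructor
  · rw [le_div_iff₀ hpos]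
    refine le_trans ?_ (hlo n hn)
    have := mul_le_mul_of_nonneg_left (hstep n hn).1 hc.le
    have := mul_le_mul_of_nonneg_left h2 hc.le
    linarith
  · rw [div_le_iff₀ hpos]
    refine (hup n hn).trans ?_
    have := mul_pos hC hposM
    linarith

lemma as_bound (β : ℝ) (hβ0 : 0 ≤ β) (hβ1 : β < 1) (μ : Measure (ℕ → ℕ)) [IsProbabilityMeasure μ]
    (C : ℝ) (hC : 0 < C) (ε : ℝ) (hε : 0 < ε)
    (h : ∀ᶠ k : ℕ in atTop, μ.real (never k) ≤ C * (1 / (k * Lf β k))) :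
    ∀ᵐ ω ∂μ, Tendsto (fun n : ℕ => (SY ω n : ℝ)
          / (Real.log n ^ (1 + ε) * Real.log (Real.log n) ^ (-β))) atTop (𝓝 0) := by
  obtain ⟨N, hN⟩ := eventually_atTop.1 (h.and ((Hf_step β hβ0 hβ1).and ((Hf_eq β).and
    ((Lf_step β hβ0 hβ1).and ((ev_loglog 1).and (eventually_ge_atTop 1))))))
  set w := fun n : ℕ => Real.log n ^ (1 + ε) * Real.log (Real.log n) ^ (-β) with hw
  have hlog : ∀ n ≥ N, 1 ≤ Real.log (n : ℝ) := fun n hn =>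
    ((hN n hn).2.2.2.2.1 n le_rfl).2.1
  have hwe : ∀ n ≥ N, w n = Real.log n ^ ε * Hf β n := by
    intro n hn
    have := hlog n hn
    simp only [hw, Hf]
    rw [Real.rpow_add (by linarith), Real.rpow_one]; ring
  have hHpos : ∀ n ≥ N, 0 < Hf β n := fun n hn => (hN n hn).2.2.1.2
  have hwpos : ∀ n ≥ N, 0 < w n := by
    intro n hn
    rw [hwe n hn]
    have := hlog n hn
    exact mul_pos (Real.rpow_pos_of_pos (by linarith) _) (hHpos n hn)
  have hstep : ∀ n ≥ N, w n ≤ w (n + 1) := by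
    intro n hn
    rw [hwe n hn, hwe (n + 1) (by omega)]
    have l1 := hlog n hn
    have n1 : (1 : ℝ) ≤ n := by exact_mod_cast (hN n hn).2.2.2.2.2
    have l2 := (hN (n + 1) (by omega)).2.2.2.1.1
    have l3 : 0 ≤ 1 / (2 * (((n + 1 : ℕ) : ℝ) * Lf β (n + 1))) := by positivity
    have l4 := (hN n hn).2.1.1
    have l5 := hHpos n hn
    have l6 : Real.log (n : ℝ) ≤ Real.log ((n + 1 : ℕ) : ℝ) :=
      Real.log_le_log (by linarith) (by push_cast; linarith)
    have l7 : Hf β n ≤ Hf β (n + 1) := by linarith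
    gcongr
  have hmono : ∀ k ≥ N, ∀ n ≥ k, w k ≤ w n := by
    intro k hk n hn
    induction n, hn using Nat.le_induction with
    | base => exact le_rfl
    | succ n hn ih => exact ih.trans (hstep n (by omega))
  have hlim : Tendsto w atTop atTop := by
    refine tendsto_atTop_mono' _ ?_ (Hf_tendsto β hβ1)
    filter_upwards [eventually_ge_atTop N] with n hn
    rw [hwe n hn]
    have h1 := Real.one_le_rpow (hlog n hn) hε.le
    have h2 := hHpos n hn
    nlinarith
  have hterm : ∀ n ≥ N, μ.real (never n) * (1 / w n)
      ≤ C * (1 / ((n : ℝ) * Real.log n ^ (1 + ε))) := by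
    intro n hn
    have h1 := (hN n hn).1
    have l1 := hlog n hn
    have n1 : (1 : ℝ) ≤ n := by exact_mod_cast (hN n hn).2.2.2.2.2
    have l2 := (hN n hn).2.2.2.1.1
    have hwp := hwpos n hn
    calc μ.real (never n) * (1 / w n) ≤ (C * (1 / (n * Lf β n))) * (1 / w n) := by gcongr
      _ = C * (1 / ((n : ℝ) * Real.log n ^ (1 + ε))) := by
        rw [hwe n hn, (hN n hn).2.2.1.1, Real.rpow_add (by linarith), Real.rpow_one]
        have : 0 < Real.log (n : ℝ) ^ ε := Real.rpow_pos_of_pos (by linarith) _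
        field_simp
  -- almost sure summability
  have hF : ∀ k : ℕ, Measurable
      ((never (k + N)).indicator (fun _ => ENNReal.ofReal (1 / w (k + N)))) := fun k =>
    measurable_const.indicator (measurableSet_never _)
  have hfin : ∫⁻ ω, ∑' k : ℕ, (never (k + N)).indicator
      (fun _ => ENNReal.ofReal (1 / w (k + N))) ω ∂μ ≠ ∞ := by
    rw [lintegral_tsum fun k => (hF k).aemeasurable]
    have hs : Summable fun k : ℕ => C * (1 / (((k + N : ℕ) : ℝ) * Real.log (k + N : ℕ) ^ (1 + ε))) :=
      ((summable_nat_add_iff N).2 (summable_log_rpow ε hε)).mul_left C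
    refine ne_top_of_le_ne_top hs.tsum_ofReal_ne_top (ENNReal.tsum_le_tsum fun k => ?_)
    rw [lintegral_indicator_const (measurableSet_never _)]
    have hwp := hwpos (k + N) (by omega)
    rw [← ofReal_measureReal (μ := μ) (s := never (k + N)), ← ENNReal.ofReal_mul (by positivity)]
    apply ENNReal.ofReal_le_ofReal
    rw [mul_comm]
    exact hterm (k + N) (by omega)
  have hae := ae_lt_top (Measurable.ennreal_tsum hF) hfin
  filter_upwards [hae] with ω hω
  have hsum := ENNReal.summable_toReal hω.ne
  have := kronecker (fun k => (never k).indicator (fun _ => (1 : ℝ)) ω) w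
    (fun k => Set.indicator_nonneg (fun _ _ => zero_le_one) ω)
    (fun k => Set.indicator_le_self' (fun _ _ => zero_le_one) ω) N hwpos hmono hlim ?_
  · refine this.congr fun n => ?_
    rw [SY_eq]
  · refine hsum.congr fun k => ?_
    have hwp := hwpos (k + N) (by omega)
    by_cases hk : ω ∈ never (k + N)
    · simp only [Set.indicator_of_mem hk]
      rw [ENNReal.toReal_ofReal (by positivity)]
    · simp [Set.indicator_of_notMem hk]

theorem number_of_cutpoints_Y
    (q p1 p2 : ℕ → ℝ)
    (hq : ∀ k, 2 ≤ k → 0 < q k) (hp1 : ∀ k, 2 ≤ k → 0 ≤ p1 k)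
    (hp2 : ∀ k, 2 ≤ k → 0 < p2 k)
    (hsum : ∀ k, 2 ≤ k → q k + p1 k + p2 k = 1)
    (μ : Measure (ℕ → ℕ)) [IsProbabilityMeasure μ]
    (hμ : IsMarkovChain μ (transY q p1 p2) 2)
    (a b : ℝ) (ha : 0 < a) (hb : 0 < b)
    (hCa : Tendsto (fun k => (p1 k + p2 k) / q k) atTop (𝓝 a))
    (hCb : Tendsto (fun k => p2 k / q k) atTop (𝓝 b))
    (β : ℝ) (hβ0 : 0 ≤ β) (hβ1 : β < 1)
    (hrho : (fun k => rho q p1 p2 k - (1 + 3 * rseq β k))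
      =O[atTop] fun k => rseq β k ^ 2) :
    (∃ c₃ c₄ : ℝ, 0 < c₃ ∧ c₃ < c₄ ∧
      c₃ ≤ Filter.liminf
        (fun n : ℕ => (∫ ω, (SY ω n : ℝ) ∂μ)
          / (Real.log n * Real.log (Real.log n) ^ (-β))) atTop ∧
      Filter.limsup
        (fun n : ℕ => (∫ ω, (SY ω n : ℝ) ∂μ)
          / (Real.log n * Real.log (Real.log n) ^ (-β))) atTop ≤ c₄) ∧
    (∀ ε : ℝ, 0 < ε →
      μ {ω | Tendsto
        (fun n : ℕ => (SY ω n : ℝ)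
          / (Real.log n ^ (1 + ε) * Real.log (Real.log n) ^ (-β)))
        atTop (𝓝 0)} = 1) := by
  obtain ⟨c, C, hc, hC, hcut⟩ := cut_bounds q p1 p2 hq hp1 hp2 hsum μ hμ a b ha hb hCa hCb
    β hβ0 hβ1 hrho
  have hev := expect_bounds β hβ0 hβ1 (fun k => μ.real (never k))
    (fun k => measureReal_nonneg) c C hc hC hcut
  refine ⟨⟨min (c / 2) 1, 2 * C + 2, by positivity, ?_, ?_, ?_⟩, ?_⟩
  · have := min_le_right (c / 2) 1
    linarith
  · simp_rw [integral_SY]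
    refine le_liminf_of_le ?_ (hev.mono fun n hn => (min_le_left _ _).trans hn.1)
    exact IsBoundedUnder.isCoboundedUnder_ge ⟨2 * C + 1, eventually_map.2 (hev.mono fun n hn => hn.2)⟩
  · simp_rw [integral_SY]
    refine limsup_le_of_le ?_ (hev.mono fun n hn => hn.2.trans (by linarith))
    exact IsBoundedUnder.isCoboundedUnder_le ⟨c / 2, eventually_map.2 (hev.mono fun n hn => hn.1)⟩
  · intro ε hε
    have h := as_bound β hβ0 hβ1 μ C hC ε hε (hcut.mono fun k hk => hk.2)
    rw [measure_congr (eventuallyEq_univ.2 h), measure_univ]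

end
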